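/- arXiv:0912.4887 — 2 statements merged into one kernel-verified Lean document; each statement's English description precedes it below -/
import Mathlib

section
/- Let S be a Noetherian scheme, let Y be an affine integral separated S-scheme of finite type with ring of regular functions B, and let X and Z be separated S-schemes of finite type. Let f : X → Y be a morphism of S-schemes, let F be the perfect closure of the fraction field Frac(B) of B, and assume that there exists a universal homeomorphism of F-schemes X ×_Y Spec F → Z ×_S Spec F. Then there exist a nonempty open subscheme U of Y, a scheme T, and universal homeomorphisms of S-schemes T → X ×_Y U and T → Z ×_S U. -/
open CategoryTheory AlgebraicGeometry CategoryTheory.Limits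

/-- A morphism of schemes is a universal homeomorphism if every base change of it
is a homeomorphism on underlying topological spaces. -/
def IsUniversalHomeomorphism {X Y : Scheme} (f : X ⟶ Y) : Prop :=
  (AlgebraicGeometry.topologically @IsHomeomorph).universally f

universe u

section UniversalHomeomorphism

variable {X Y Z : Scheme}

theorem IsUniversalHomeomorphism.mk' (f : X ⟶ Y) [UniversallyClosed f]
    [UniversallyInjective f] [Surjective f] : IsUniversalHomeomorphism f := by
  intro X' Y' i₁ i₂ f' H
  have : UniversallyClosed f' := MorphismProperty.of_isPullback H.flip ‹UniversallyClosed f›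
  have : UniversallyInjective f' := MorphismProperty.of_isPullback H.flip ‹UniversallyInjective f›
  have : Surjective f' := MorphismProperty.of_isPullback H.flip ‹Surjective f›
  exact isHomeomorph_iff_continuous_isClosedMap_bijective.mpr
    ⟨f'.continuous, f'.isClosedMap, f'.injective, f'.surjective⟩

theorem IsUniversalHomeomorphism.universallyClosed {f : X ⟶ Y}
    (hf : IsUniversalHomeomorphism f) : UniversallyClosed f :=
  ⟨fun _ _ _ _ _ H ↦ (hf _ _ _ H).isClosedMap⟩

theorem IsUniversalHomeomorphism.universallyInjective {f : X ⟶ Y}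
    (hf : IsUniversalHomeomorphism f) : UniversallyInjective f :=
  ⟨fun _ _ _ _ _ H ↦ (hf _ _ _ H).injective⟩

theorem IsUniversalHomeomorphism.surjective {f : X ⟶ Y}
    (hf : IsUniversalHomeomorphism f) : Surjective f :=
  ⟨(hf _ _ _ (IsPullback.of_id_snd)).surjective⟩

theorem IsUniversalHomeomorphism.comp {f : X ⟶ Y} {g : Y ⟶ Z}
    (hf : IsUniversalHomeomorphism f) (hg : IsUniversalHomeomorphism g) :
    IsUniversalHomeomorphism (f ≫ g) := by
  have := hf.universallyClosed
  have := hg.universallyClosed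
  have := hf.universallyInjective
  have := hg.universallyInjective
  have := hf.surjective
  have := hg.surjective
  have : UniversallyInjective (f ≫ g) := MorphismProperty.comp_mem _ _ _ ‹_› ‹_›
  exact .mk' _

theorem IsUniversalHomeomorphism.of_isPullback {P : Scheme} {f : X ⟶ Y}
    {fst : P ⟶ X} {snd : P ⟶ Z} {g : Z ⟶ Y} (H : IsPullback fst snd f g)
    (hf : IsUniversalHomeomorphism f) : IsUniversalHomeomorphism snd :=
  (MorphismProperty.universally_isStableUnderBaseChange _).of_isPullback H hf

theorem LocallyQuasiFinite.of_universallyInjective (f : X ⟶ Y) [LocallyOfFiniteType f]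
    [UniversallyInjective f] : LocallyQuasiFinite f :=
  locallyQuasiFinite_iff_isDiscrete_preimage_singleton.mpr fun _ ↦
    (Set.Subsingleton.isDiscrete (Set.subsingleton_singleton.preimage f.injective))

theorem IsUniversalHomeomorphism.isFinite {f : X ⟶ Y} (hf : IsUniversalHomeomorphism f)
    [LocallyOfFiniteType f] [QuasiCompact f] [IsSeparated f] : IsFinite f := by
  have := hf.universallyClosed
  have := hf.universallyInjective
  have := LocallyQuasiFinite.of_universallyInjective f
  have : IsProper f := {}
  exact .of_isProper_of_locallyQuasiFinite f

end UniversalHomeomorphism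

section CartesianSystem

variable {I : Type u} [Category.{u} I] {D : I ⥤ Scheme.{u}}

/-- A diagram of schemes with a limit cone, together with a cartesian morphism to a diagram `D`
equipped with a cone `c`. -/
structure CartesianSystem (c : Cone D) where
  /-- The diagram. -/
  diagram : I ⥤ Scheme.{u}
  /-- The limit cone over the diagram. -/
  cone : Cone diagram
  isLimit : IsLimit cone
  /-- The components of the morphism of diagrams. -/
  hom (i : I) : diagram.obj i ⟶ D.obj i
  /-- The morphism on the vertices of the cones. -/
  homPt : cone.pt ⟶ c.pt
  isPullback_map {i j : I} (a : i ⟶ j) :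
    IsPullback (diagram.map a) (hom i) (hom j) (D.map a)
  isPullback_π (i : I) : IsPullback (cone.π.app i) homPt (hom i) (c.π.app i)

variable {S X : Scheme.{u}} (t : ∀ i, D.obj i ⟶ S)
  (ht : ∀ {i j : I} (a : i ⟶ j), D.map a ≫ t j = t i) (h : X ⟶ S)

/-- The base change along `h : X ⟶ S` of a diagram of schemes over `S`. -/
noncomputable def pullbackDiagram : I ⥤ Scheme.{u} where
  obj i := pullback h (t i)
  map {i j} a := pullback.lift (pullback.fst h (t i)) (pullback.snd h (t i) ≫ D.map a)
    (by rw [Category.assoc, ht, pullback.condition])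
  map_id i := by apply pullback.hom_ext <;> simp
  map_comp {i j k} a b := by
    apply pullback.hom_ext
    · rw [pullback.lift_fst, Category.assoc, pullback.lift_fst, pullback.lift_fst]
    · rw [pullback.lift_snd, Category.assoc, pullback.lift_snd, pullback.lift_snd_assoc,
        Functor.map_comp, Category.assoc]

/-- The projection of the base change along `h : X ⟶ S` to `X`. -/
noncomputable def pullbackDiagramFst (i : I) : (pullbackDiagram t ht h).obj i ⟶ X :=
  pullback.fst h (t i)

/-- The projection of the base change along `h : X ⟶ S` to the given diagram. -/
noncomputable def pullbackDiagramSnd (i : I) : (pullbackDiagram t ht h).obj i ⟶ D.obj i :=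
  pullback.snd h (t i)

theorem isPullback_pullbackDiagram (i : I) :
    IsPullback (pullbackDiagramFst t ht h i) (pullbackDiagramSnd t ht h i) h (t i) :=
  IsPullback.of_hasPullback h (t i)

theorem pullbackDiagram_map_fst {i j : I} (a : i ⟶ j) :
    (pullbackDiagram t ht h).map a ≫ pullbackDiagramFst t ht h j = pullbackDiagramFst t ht h i :=
  pullback.lift_fst _ _ _

theorem pullbackDiagram_map_snd {i j : I} (a : i ⟶ j) :
    (pullbackDiagram t ht h).map a ≫ pullbackDiagramSnd t ht h j =
      pullbackDiagramSnd t ht h i ≫ D.map a :=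
  pullback.lift_snd _ _ _

theorem isPullback_pullbackDiagram_map {i j : I} (a : i ⟶ j) :
    IsPullback ((pullbackDiagram t ht h).map a) (pullbackDiagramSnd t ht h i)
      (pullbackDiagramSnd t ht h j) (D.map a) := by
  refine IsPullback.of_right (h₁₂ := pullbackDiagramFst t ht h j) (v₁₃ := h) (h₂₂ := t j)
    ?_ (pullbackDiagram_map_snd t ht h a) (isPullback_pullbackDiagram t ht h j)
  rw [ht, pullbackDiagram_map_fst]
  exact isPullback_pullbackDiagram t ht h i

variable (c : Cone D) (r : c.pt ⟶ S) (hr : ∀ i, c.π.app i ≫ t i = r)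

/-- The leg of the base change along `h : X ⟶ S` of a cone over a diagram of schemes over `S`. -/
noncomputable def pullbackDiagramConeπ (i : I) : pullback h r ⟶ (pullbackDiagram t ht h).obj i :=
  pullback.lift (pullback.fst h r) (pullback.snd h r ≫ c.π.app i)
    (by rw [Category.assoc, hr, pullback.condition])

theorem pullbackDiagramConeπ_fst (i : I) :
    pullbackDiagramConeπ t ht h c r hr i ≫ pullbackDiagramFst t ht h i = pullback.fst h r :=
  pullback.lift_fst _ _ _

theorem pullbackDiagramConeπ_snd (i : I) :
    pullbackDiagramConeπ t ht h c r hr i ≫ pullbackDiagramSnd t ht h i =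
      pullback.snd h r ≫ c.π.app i :=
  pullback.lift_snd _ _ _

theorem isPullback_pullbackDiagramConeπ (i : I) :
    IsPullback (pullbackDiagramConeπ t ht h c r hr i) (pullback.snd h r)
      (pullbackDiagramSnd t ht h i) (c.π.app i) := by
  refine IsPullback.of_right (h₁₂ := pullbackDiagramFst t ht h i) (v₁₃ := h) (h₂₂ := t i)
    ?_ (pullbackDiagramConeπ_snd t ht h c r hr i) (isPullback_pullbackDiagram t ht h i)
  rw [hr, pullbackDiagramConeπ_fst]
  exact IsPullback.of_hasPullback h r

/-- The base change along `h : X ⟶ S` of a cone over a diagram of schemes over `S`. -/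
noncomputable def pullbackDiagramCone : Cone (pullbackDiagram t ht h) where
  pt := pullback h r
  π := { app := pullbackDiagramConeπ t ht h c r hr
         naturality i j a := by
          refine (Category.id_comp _).trans ((isPullback_pullbackDiagram t ht h j).hom_ext ?_ ?_)
          · rw [Category.assoc, pullbackDiagram_map_fst, pullbackDiagramConeπ_fst,
              pullbackDiagramConeπ_fst]
          · rw [Category.assoc, pullbackDiagram_map_snd, pullbackDiagramConeπ_snd,
              ← Category.assoc, pullbackDiagramConeπ_snd, Category.assoc, c.w] }

/-- The base change along `h : X ⟶ S` of a connected diagram of schemes over `S` with a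
limit cone. -/
noncomputable def pullbackSystem [IsConnected I] (hc : IsLimit c) : CartesianSystem c where
  diagram := pullbackDiagram t ht h
  cone := pullbackDiagramCone t ht h c r hr
  isLimit := isLimitOfIsPullbackOfIsConnected
    { app := pullbackDiagramSnd t ht h, naturality _ _ a := pullbackDiagram_map_snd t ht h a } _ c
    { hom := pullback.snd h r, w i := (pullbackDiagramConeπ_snd t ht h c r hr i).symm }
    (isPullback_pullbackDiagramConeπ t ht h c r hr) hc
  hom := pullbackDiagramSnd t ht h
  homPt := pullback.snd h r
  isPullback_map := isPullback_pullbackDiagram_map t ht h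
  isPullback_π := isPullback_pullbackDiagramConeπ t ht h c r hr

namespace CartesianSystem

variable {c} (C : CartesianSystem c)

theorem isAffineHom_map [∀ {i j : I} (a : i ⟶ j), IsAffineHom (D.map a)]
    {i j : I} (a : i ⟶ j) : IsAffineHom (C.diagram.map a) :=
  MorphismProperty.of_isPullback (C.isPullback_map a).flip
    (inferInstanceAs (IsAffineHom (D.map a)))

theorem exists_surjective [IsCofiltered I] [∀ {i j : I} (a : i ⟶ j), IsAffineHom (D.map a)]
    (hc : IsLimit c) (i : I) [IsNoetherian (D.obj i)] (hi : IsClosedMap (C.hom i))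
    [Surjective C.homPt] : ∃ (j : I) (_ : j ⟶ i), Surjective (C.hom j) := by
  let U : (D.obj i).Opens := ⟨(Set.range (C.hom i))ᶜ, hi.isClosed_range.isOpen_compl⟩
  have hU : IsCompact (U : Set (D.obj i)) := TopologicalSpace.NoetherianSpace.isCompact _
  obtain ⟨j, a, hj⟩ := exists_map_preimage_le_map_preimage D c hc (U := U) (V := ⊥) hU <| by
    intro x hx
    obtain ⟨y, rfl⟩ := C.homPt.surjective x
    refine (hx ⟨C.cone.π.app i y, ?_⟩).elim
    rw [← Scheme.Hom.comp_apply, ← Scheme.Hom.comp_apply, (C.isPullback_π i).w]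
  refine ⟨j, a, ⟨fun x ↦ ?_⟩⟩
  have hx : D.map a x ∈ Set.range (C.hom i) := by
    by_contra hx
    exact hj (show x ∈ D.map a ⁻¹ᵁ U from hx)
  obtain ⟨y, hy⟩ := hx
  obtain ⟨z, -, hz⟩ :=
    Scheme.exists_preimage_of_isPullback (C.isPullback_map a) y x hy
  exact ⟨z, hz⟩

theorem _root_.RingHom.IsIntegralElem.of_comp_eq_comp {A A' E E' : Type*} [CommRing A]
    [CommRing A'] [CommRing E] [CommRing E'] {f : A →+* E} {f' : A' →+* E'} {g : A →+* A'}
    {v : E →+* E'} (hfg : f'.comp g = v.comp f) {x : E} (hx : f.IsIntegralElem x) :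
    f'.IsIntegralElem (v x) :=
  RingHom.IsIntegralElem.of_comp (f := g) (g := f') (hfg ▸ hx.map v)

theorem _root_.CategoryTheory.IsPushout.isIntegral_commRingCat {A A' E E' : CommRingCat.{u}}
    {f : A ⟶ E} {g : A ⟶ A'} {v : E ⟶ E'} {f' : A' ⟶ E'} (H : IsPushout f g v f')
    (s : Set E) (hs : Algebra.adjoin (f.hom.range) s = ⊤)
    (h : ∀ x ∈ s, f'.hom.IsIntegralElem (v.hom x)) : f'.hom.IsIntegral := by
  algebraize [f'.hom]
  let N : Subring E' := (integralClosure A' E').toSubring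
  have hv (x : E) : v.hom x ∈ N := by
    have hx : x ∈ Algebra.adjoin (f.hom.range) s := hs ▸ Algebra.mem_top
    induction hx using Algebra.adjoin_induction with
    | mem x hx => exact h x hx
    | algebraMap r =>
      obtain ⟨_, r, rfl⟩ := r
      exact (congr($(H.w).hom r) : v.hom (f.hom r) = f'.hom (g.hom r)) ▸
        RingHom.isIntegralElem_map f'.hom
    | add x y _ _ hx hy => exact (map_add v.hom x y) ▸ add_mem hx hy
    | mul x y _ _ hx hy => exact (map_mul v.hom x y) ▸ mul_mem hx hy
  have hf (x : A') : f'.hom x ∈ N := RingHom.isIntegralElem_map f'.hom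
  let d : E' ⟶ CommRingCat.of N := H.desc (CommRingCat.ofHom (v.hom.codRestrict N hv))
    (CommRingCat.ofHom (f'.hom.codRestrict N hf))
    (by ext x; exact congr($(H.w).hom x))
  have hd : d ≫ CommRingCat.ofHom N.subtype = 𝟙 _ := by
    refine H.hom_ext ?_ ?_
    · rw [H.inl_desc_assoc]; rfl
    · rw [H.inr_desc_assoc]; rfl
  intro x
  have := (d.hom x).2
  rwa [show (d.hom x : E') = x from congr($(hd).hom x)] at this

theorem isIntegralElem_map {j k : I} (a : k ⟶ j) {e : Γ(C.diagram.obj j, ⊤)}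
    (he : (C.hom j).appTop.hom.IsIntegralElem e) :
    (C.hom k).appTop.hom.IsIntegralElem ((C.diagram.map a).appTop.hom e) := by
  refine RingHom.IsIntegralElem.of_comp_eq_comp (g := (D.map a).appTop.hom) ?_ he
  rw [← CommRingCat.hom_comp, ← CommRingCat.hom_comp, ← Scheme.Hom.comp_appTop,
    ← Scheme.Hom.comp_appTop, (C.isPullback_map a).w]

variable [IsCofiltered I] [∀ {i j : I} (a : i ⟶ j), IsAffineHom (D.map a)]

theorem _root_.exists_subset_range_appTop_π (hc : IsLimit c) [∀ i, CompactSpace (D.obj i)]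
    [∀ i, QuasiSeparatedSpace (D.obj i)] (s : Finset Γ(c.pt, ⊤)) (i : I) :
    ∃ (j : I) (_ : j ⟶ i), (s : Set Γ(c.pt, ⊤)) ⊆ Set.range (c.π.app j).appTop := by
  classical
  induction s using Finset.induction_on with
  | empty => exact ⟨i, 𝟙 i, by simp⟩
  | insert e s _ ih =>
    obtain ⟨j, a, hj⟩ := ih
    obtain ⟨k, x, rfl⟩ := exists_appTop_π_eq_of_isLimit D c hc e
    obtain ⟨l, p, q, -⟩ := IsCofilteredOrEmpty.cone_objs j k
    refine ⟨l, p ≫ a, ?_⟩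
    rw [Finset.coe_insert, Set.insert_subset_iff]
    refine ⟨⟨(D.map q).appTop x, ?_⟩, fun y hy ↦ ?_⟩
    · rw [← CommRingCat.comp_apply, ← Scheme.Hom.comp_appTop, c.w]
    · obtain ⟨y, rfl⟩ := hj hy
      refine ⟨(D.map p).appTop y, ?_⟩
      rw [← CommRingCat.comp_apply, ← Scheme.Hom.comp_appTop, c.w]

theorem exists_isIntegralElem (hc : IsLimit c) [∀ i, CompactSpace (D.obj i)]
    [∀ i, QuasiSeparatedSpace (D.obj i)] [∀ i, CompactSpace (C.diagram.obj i)]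
    (hC : C.homPt.appTop.hom.IsIntegral) {j : I} (e : Γ(C.diagram.obj j, ⊤)) :
    ∃ (k : I) (a : k ⟶ j),
      (C.hom k).appTop.hom.IsIntegralElem ((C.diagram.map a).appTop.hom e) := by
  classical
  have := @C.isAffineHom_map
  obtain ⟨p, hp, hpe⟩ := hC ((C.cone.π.app j).appTop.hom e)
  obtain ⟨k, a, hk⟩ := exists_subset_range_appTop_π hc p.coeffs j
  obtain ⟨q, rfl, -, hq⟩ := Polynomial.lifts_and_natDegree_eq_and_monic
    ((Polynomial.lifts_iff_coeffs_subset_range (f := (c.π.app k).appTop.hom) p).mpr hk) hp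
  obtain ⟨l, b, hl⟩ := exists_appTop_map_eq_zero_of_isLimit C.diagram C.cone C.isLimit (i := k)
    (q.eval₂ (C.hom k).appTop.hom ((C.diagram.map a).appTop.hom e)) <| by
      rw [← hpe, Polynomial.eval₂_map, ← CommRingCat.hom_comp, ← Scheme.Hom.comp_appTop,
        ← (C.isPullback_π k).w]
      refine (Polynomial.hom_eval₂ _ _ (C.cone.π.app k).appTop.hom _).trans ?_
      rw [← CommRingCat.hom_comp, ← Scheme.Hom.comp_appTop, ← CommRingCat.comp_apply,
        ← Scheme.Hom.comp_appTop, C.cone.w]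
  refine ⟨l, b ≫ a, q.map (D.map b).appTop.hom, hq.map _, ?_⟩
  refine Eq.trans ?_ hl
  rw [Polynomial.eval₂_map, ← CommRingCat.hom_comp, ← Scheme.Hom.comp_appTop,
    ← (C.isPullback_map b).w]
  refine Eq.trans ?_ (Polynomial.hom_eval₂ _ _ (C.diagram.map b).appTop.hom _).symm
  rw [← CommRingCat.hom_comp, ← Scheme.Hom.comp_appTop, ← CommRingCat.comp_apply,
        ← Scheme.Hom.comp_appTop, Functor.map_comp]

theorem exists_forall_isIntegralElem (hc : IsLimit c) [∀ i, CompactSpace (D.obj i)]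
    [∀ i, QuasiSeparatedSpace (D.obj i)] [∀ i, CompactSpace (C.diagram.obj i)]
    (hC : C.homPt.appTop.hom.IsIntegral) {j : I} (s : Finset Γ(C.diagram.obj j, ⊤)) :
    ∃ (k : I) (a : k ⟶ j), ∀ e ∈ s,
      (C.hom k).appTop.hom.IsIntegralElem ((C.diagram.map a).appTop.hom e) := by
  classical
  induction s using Finset.induction_on with
  | empty => exact ⟨j, 𝟙 j, by simp⟩
  | insert e s _ ih =>
    obtain ⟨k, a, hk⟩ := ih
    obtain ⟨l, b, hl⟩ := C.exists_isIntegralElem hc hC e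
    obtain ⟨m, p, q, w⟩ := IsCofiltered.cospan a b
    refine ⟨m, p ≫ a, fun x hx ↦ ?_⟩
    obtain rfl | hx := Finset.mem_insert.mp hx
    · rw [w, Functor.map_comp, Scheme.Hom.comp_appTop]
      exact C.isIntegralElem_map q hl
    · rw [Functor.map_comp, Scheme.Hom.comp_appTop]
      exact C.isIntegralElem_map p (hk x hx)

theorem exists_isIntegralHom (hc : IsLimit c) [∀ i, IsAffine (D.obj i)]
    [∀ i, CompactSpace (C.diagram.obj i)] [∀ i, QuasiSeparatedSpace (C.diagram.obj i)]
    [∀ i, LocallyOfFiniteType (C.hom i)] [IsIntegralHom C.homPt] :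
    ∃ i, IsIntegralHom (C.hom i) := by
  have := @C.isAffineHom_map
  have : IsAffine c.pt := Scheme.isAffine_of_isLimit _ hc
  have : IsAffine C.cone.pt := isAffine_of_isAffineHom C.homPt
  obtain ⟨j, hj⟩ := Scheme.exists_isAffine_of_isLimit C.diagram C.cone C.isLimit
  obtain ⟨s, hs⟩ := HasRingHomProperty.appTop @LocallyOfFiniteType (C.hom j) inferInstance
  obtain ⟨k, a, hk⟩ := C.exists_forall_isIntegralElem hc
    (IsIntegralHom.isIntegral_app C.homPt ⊤ (isAffineOpen_top _)) s
  have : IsAffine (C.diagram.obj k) := isAffine_of_isAffineHom (C.diagram.map a)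
  refine ⟨k, ((IsIntegralHom.hasAffineProperty).iff_of_isAffine).mpr ⟨this, ?_⟩⟩
  refine (isPushout_appTop_of_isPullback (C.isPullback_map a)).isIntegral_commRingCat
    (s : Set _) ?_ hk
  rw [eq_top_iff]
  rintro x -
  have hx : x ∈ @Algebra.adjoin _ _ _ _ (C.hom j).appTop.hom.toAlgebra (s : Set _) := by
    rw [hs]; trivial
  induction hx using Algebra.adjoin_induction with
  | mem x hx => exact Algebra.subset_adjoin hx
  | algebraMap r => exact Subalgebra.algebraMap_mem _ (⟨_, r, rfl⟩ : (C.hom j).appTop.hom.range)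
  | add x y _ _ hx hy => exact add_mem hx hy
  | mul x y _ _ hx hy => exact mul_mem hx hy

end CartesianSystem

theorem exists_isPullback_snd_snd {X S V D : Scheme.{u}} (h : X ⟶ S) (v : V ⟶ S) (t : D ⟶ S) :
    ∃ e, IsPullback e (pullback.snd (pullback.snd h v) (pullback.fst v t))
      (pullback.snd h t) (pullback.snd v t) := by
  refine ⟨_, IsPullback.of_right' (h₁₃ := pullback.fst _ _ ≫ pullback.fst h v) ?_
    (IsPullback.of_hasPullback h t)⟩
  rw [← pullback.condition]
  exact (IsPullback.of_hasPullback _ _).paste_horiz (IsPullback.of_hasPullback h v)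

theorem isIntegralHom_snd_of_openCover {X S D : Scheme.{u}} (h : X ⟶ S) (t : D ⟶ S)
    (𝒰 : S.OpenCover) (H : ∀ k, IsIntegralHom
      (pullback.snd (pullback.snd h (𝒰.f k)) (pullback.fst (𝒰.f k) t))) :
    IsIntegralHom (pullback.snd h t) := by
  have : IsZariskiLocalAtTarget @IsIntegralHom :=
    (HasAffineProperty.iff.mp IsIntegralHom.hasAffineProperty).1
  refine IsZariskiLocalAtTarget.of_openCover (P := @IsIntegralHom) (𝒰.pullback₂ t) fun k ↦ ?_
  obtain ⟨e, he⟩ := exists_isPullback_snd_snd h (𝒰.f k) t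
  have := H k
  change IsIntegralHom (pullback.snd (pullback.snd h t) (pullback.snd (𝒰.f k) t))
  rw [← he.isoPullback_inv_snd]
  infer_instance

include ht in
theorem isIntegralHom_snd_of_hom {i j : I} (a : i ⟶ j) [IsIntegralHom (pullback.snd h (t j))] :
    IsIntegralHom (pullback.snd h (t i)) :=
  MorphismProperty.of_isPullback (isPullback_pullbackDiagram_map t ht h a) ‹_›

section

variable [IsCofiltered I]

include ht hr in
theorem exists_isIntegralHom_of_isAffine (hc : IsLimit c) [∀ i, IsAffineHom (t i)]
    [IsConnected I] [LocallyOfFiniteType h] [QuasiCompact h] [QuasiSeparated h]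
    [IsIntegralHom (pullback.snd h r)] {V : Scheme.{u}} [IsAffine V] (v : V ⟶ S) :
    ∃ i, IsIntegralHom (pullback.snd (pullback.snd h v) (pullback.fst v (t i))) := by
  let E := pullbackSystem t ht v c r hr hc
  let C := pullbackSystem (pullbackDiagramFst t ht v) (pullbackDiagram_map_fst t ht v)
    (pullback.snd h v) (pullbackDiagramCone t ht v c r hr) (pullback.fst v r)
    (pullbackDiagramConeπ_fst t ht v c r hr) E.isLimit
  have (i : I) : IsAffine ((pullbackDiagram t ht v).obj i) :=
    have : IsAffineHom (pullbackDiagramFst t ht v i) :=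
      MorphismProperty.of_isPullback (isPullback_pullbackDiagram t ht v i).flip
        (inferInstanceAs (IsAffineHom (t i)))
    isAffine_of_isAffineHom (pullbackDiagramFst t ht v i)
  have (i : I) : CompactSpace (C.diagram.obj i) :=
    (inferInstance : QuasiCompact (pullback.snd (pullback.snd h v)
      (pullbackDiagramFst t ht v i))).compactSpace_of_compactSpace
  have (i : I) : QuasiSeparatedSpace (C.diagram.obj i) :=
    have : QuasiSeparated (pullback.snd h v) :=
      MorphismProperty.of_isPullback (IsPullback.of_hasPullback _ _) inferInstance
    have : QuasiSeparated (C.hom i) :=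
      MorphismProperty.of_isPullback (IsPullback.of_hasPullback _ _) this
    quasiSeparatedSpace_of_quasiSeparated (C.hom i)
  have (i : I) : LocallyOfFiniteType (C.hom i) :=
    inferInstanceAs (LocallyOfFiniteType (pullback.snd (pullback.snd h v)
      (pullbackDiagramFst t ht v i)))
  have : IsIntegralHom C.homPt := by
    obtain ⟨e, he⟩ := exists_isPullback_snd_snd h v r
    exact MorphismProperty.of_isPullback he ‹IsIntegralHom (pullback.snd h r)›
  exact C.exists_isIntegralHom E.isLimit

include ht hr in
theorem exists_isIntegralHom_snd (hc : IsLimit c) [∀ i, IsAffineHom (t i)]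
    [IsConnected I] [LocallyOfFiniteType h] [QuasiCompact h] [QuasiSeparated h] [CompactSpace S]
    [IsIntegralHom (pullback.snd h r)] : ∃ i, IsIntegralHom (pullback.snd h (t i)) := by
  classical
  let 𝒰 := S.affineCover.finiteSubcover
  have (k : 𝒰.I₀) : IsAffine (𝒰.X k) := inferInstanceAs (IsAffine (S.affineCover.X _))
  choose i hi using fun k ↦ exists_isIntegralHom_of_isAffine t ht h c r hr hc (𝒰.f k)
  obtain ⟨j, hj⟩ := IsCofiltered.inf_objs_exists (Finset.univ.image i)
  refine ⟨j, isIntegralHom_snd_of_openCover h (t j) 𝒰 fun k ↦ ?_⟩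
  obtain ⟨a⟩ := hj (Finset.mem_image_of_mem i (Finset.mem_univ k))
  have : IsIntegralHom (pullback.snd (pullback.snd h (𝒰.f k))
      (pullbackDiagramFst t ht (𝒰.f k) (i k))) := hi k
  exact isIntegralHom_snd_of_hom (pullbackDiagramFst t ht (𝒰.f k))
    (pullbackDiagram_map_fst t ht (𝒰.f k)) (pullback.snd h (𝒰.f k)) a

theorem surjective_snd_diagonal_iff {X S D : Scheme.{u}} (h : X ⟶ S) (t : D ⟶ S) :
    Surjective (pullback.snd (pullback.diagonal h) (pullback.fst (pullback.fst h h ≫ h) t)) ↔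
      UniversallyInjective (pullback.snd h t) := by
  rw [UniversallyInjective.iff_diagonal]
  set f := pullback.snd h t
  let a : pullback f f ⟶ pullback h h := pullback.lift (pullback.fst f f ≫ pullback.fst h t)
    (pullback.snd f f ≫ pullback.fst h t)
    (by rw [Category.assoc, Category.assoc, pullback.condition, pullback.condition_assoc])
  have H₁ : IsPullback a (pullback.fst f f) (pullback.fst h h) (pullback.fst h t) := by
    refine IsPullback.of_right (h₁₂ := pullback.snd h h) (v₁₃ := h) (h₂₂ := h) ?_
      (pullback.lift_fst _ _ _) (IsPullback.of_hasPullback h h).flip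
    rw [pullback.lift_snd, pullback.condition]
    exact (IsPullback.of_hasPullback f f).flip.paste_horiz (IsPullback.of_hasPullback h t)
  have H₂ : IsPullback a (pullback.fst f f ≫ f) (pullback.fst h h ≫ h) t :=
    H₁.paste_vert (IsPullback.of_hasPullback h t)
  have H₃ : IsPullback (pullback.diagonal f) (pullback.fst h t) a (pullback.diagonal h) := by
    refine IsPullback.of_right (h₁₂ := pullback.fst f f) (v₁₃ := pullback.fst h t)
      (h₂₂ := pullback.fst h h) ?_ ?_ H₁.flip
    · rw [pullback.diagonal_fst, pullback.diagonal_fst]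
      exact IsPullback.of_horiz_isIso ⟨by simp⟩
    · apply pullback.hom_ext
      · rw [Category.assoc, pullback.lift_fst, pullback.diagonal_fst_assoc, Category.assoc,
          pullback.diagonal_fst, Category.comp_id]
      · rw [Category.assoc, pullback.lift_snd, pullback.diagonal_snd_assoc, Category.assoc,
          pullback.diagonal_snd, Category.comp_id]
  let ψ := H₂.isoPullback
  have H₄ : IsPullback ψ.hom a (pullback.fst (pullback.fst h h ≫ h) t) (𝟙 _) :=
    IsPullback.of_horiz_isIso ⟨by simp [ψ]⟩
  have H₅ := H₃.paste_horiz H₄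
  rw [Category.comp_id] at H₅
  rw [← H₅.flip.isoPullback_inv_snd]
  constructor
  · intro H
    have : pullback.diagonal f = H₅.flip.isoPullback.hom ≫
      (H₅.flip.isoPullback.inv ≫ pullback.diagonal f ≫ ψ.hom) ≫ ψ.inv := by simp
    rw [this]
    infer_instance
  · intro H
    infer_instance

include ht hr in
theorem exists_universallyInjective_snd (hc : IsLimit c) [∀ i, IsAffineHom (t i)]
    [∀ {i j : I} (a : i ⟶ j), IsAffineHom (D.map a)] [∀ i, IsNoetherian (D.obj i)]
    [IsConnected I] [LocallyOfFiniteType h] [QuasiCompact h] [IsSeparated h]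
    [UniversallyInjective (pullback.snd h r)] (i : I) :
    ∃ (j : I) (_ : j ⟶ i), UniversallyInjective (pullback.snd h (t j)) := by
  let p := pullback.fst h h ≫ h
  let E := pullbackSystem t ht p c r hr hc
  let C := pullbackSystem (pullbackDiagramFst t ht p) (pullbackDiagram_map_fst t ht p)
    (pullback.diagonal h) (pullbackDiagramCone t ht p c r hr) (pullback.fst p r)
    (pullbackDiagramConeπ_fst t ht p c r hr) E.isLimit
  have : IsNoetherian ((pullbackDiagram t ht p).obj i) := by
    have : IsLocallyNoetherian (pullback p (t i)) :=
      LocallyOfFiniteType.isLocallyNoetherian (pullback.snd p (t i))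
    have : CompactSpace ↥(pullback p (t i)) :=
      (inferInstance : QuasiCompact (pullback.snd p (t i))).compactSpace_of_compactSpace
    exact { toIsLocallyNoetherian := ‹_›, toCompactSpace := ‹_› }
  have : IsClosedImmersion (C.hom i) :=
    MorphismProperty.of_isPullback (IsPullback.of_hasPullback _ _)
      (inferInstanceAs (IsClosedImmersion (pullback.diagonal h)))
  have : Surjective C.homPt := (surjective_snd_diagonal_iff h r).mpr ‹_›
  have := @E.isAffineHom_map
  have {i j : I} (a : i ⟶ j) : IsAffineHom ((pullbackDiagram t ht p).map a) := this a
  obtain ⟨j, a, hj⟩ := C.exists_surjective E.isLimit i (C.hom i).isClosedEmbedding.isClosedMap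
  exact ⟨j, a, (surjective_snd_diagonal_iff h (t j)).mp hj⟩

include ht hr in
theorem exists_isUniversalHomeomorphism_snd (hc : IsLimit c) [∀ i, IsAffineHom (t i)]
    [∀ {i j : I} (a : i ⟶ j), IsAffineHom (D.map a)] [∀ i, IsNoetherian (D.obj i)]
    [IsConnected I] [CompactSpace S] [LocallyOfFiniteType h] [QuasiCompact h] [IsSeparated h]
    (H : IsUniversalHomeomorphism (pullback.snd h r)) :
    ∃ (i : I), IsUniversalHomeomorphism (pullback.snd h (t i)) := by
  have := H.surjective
  have := H.universallyInjective
  have : IsFinite (pullback.snd h r) := H.isFinite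
  obtain ⟨i, hi⟩ := exists_isIntegralHom_snd t ht h c r hr hc
  obtain ⟨j, a, hj⟩ := exists_universallyInjective_snd t ht h c r hr hc i
  have : IsIntegralHom (pullback.snd h (t j)) := isIntegralHom_snd_of_hom t ht h a
  have hcl : IsClosedMap (pullback.snd h (t j)) := Scheme.Hom.isClosedMap _
  let C := pullbackSystem t ht h c r hr hc
  have : Surjective C.homPt := ‹Surjective (pullback.snd h r)›
  obtain ⟨k, b, hk⟩ := C.exists_surjective hc j hcl
  have : IsIntegralHom (pullback.snd h (t k)) := isIntegralHom_snd_of_hom t ht h b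
  have : UniversallyInjective (pullback.snd h (t k)) :=
    MorphismProperty.of_isPullback (isPullback_pullbackDiagram_map t ht h b) hj
  have : Surjective (pullback.snd h (t k)) := hk
  exact ⟨k, .mk' _⟩

end

end CartesianSystem

section FGSubalgebra

variable (B A : Type u) [CommRing B] [CommRing A] [Algebra B A]

/-- The directed set of finitely generated subalgebras. -/
abbrev FGSubalgebra : Type u := {C : Subalgebra B A // C.FG}

instance : IsDirectedOrder (FGSubalgebra B A) :=
  ⟨fun C D ↦ ⟨⟨C.1 ⊔ D.1, C.2.sup D.2⟩, (le_sup_left : C.1 ≤ _), (le_sup_right : D.1 ≤ _)⟩⟩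

instance : Nonempty (FGSubalgebra B A) := ⟨⟨⊥, Subalgebra.fg_bot⟩⟩

/-- The spectra of the finitely generated subalgebras. -/
noncomputable def specDiagram : (FGSubalgebra B A)ᵒᵖ ⥤ Scheme.{u} where
  obj C := Spec (CommRingCat.of C.unop.1)
  map {C D} a := Spec.map (CommRingCat.ofHom
    (Subalgebra.inclusion (leOfHom a.unop)).toRingHom)
  map_id C := Spec.map_id _
  map_comp a b := by rw [← Spec.map_comp]; rfl

/-- The spectrum of an algebra as a cone over the spectra of its finitely generated subalgebras. -/
noncomputable def specCone : Cone (specDiagram B A) where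
  pt := Spec (CommRingCat.of A)
  π := { app C := Spec.map (CommRingCat.ofHom C.unop.1.val.toRingHom)
         naturality C D a := (Category.id_comp _).trans <| by
           dsimp [specDiagram]; rw [← Spec.map_comp]; rfl }

/-- The diagram of finitely generated subalgebras. -/
noncomputable def fgDiagram : FGSubalgebra B A ⥤ CommRingCat.{u} where
  obj C := CommRingCat.of C.1
  map {C D} a := CommRingCat.ofHom (Subalgebra.inclusion (leOfHom a)).toRingHom

/-- An algebra as a cocone over its finitely generated subalgebras. -/
noncomputable def fgCocone : Cocone (fgDiagram B A) where
  pt := CommRingCat.of A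
  ι := { app C := CommRingCat.ofHom C.1.val.toRingHom }

variable {B A}

/-- The subalgebra generated by a finite set. -/
noncomputable def FGSubalgebra.adjoin (s : Finset A) : FGSubalgebra B A :=
  ⟨Algebra.adjoin B (s : Set A), Subalgebra.fg_adjoin_finset s⟩

theorem FGSubalgebra.mem_adjoin {s : Finset A} {x : A} (hx : x ∈ s) :
    x ∈ (FGSubalgebra.adjoin (B := B) s).1 :=
  Algebra.subset_adjoin hx

theorem fgCocone_ι_eq (s : Cocone (fgDiagram B A)) {C D : FGSubalgebra B A} {x : A}
    (hC : x ∈ C.1) (hD : x ∈ D.1) :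
    (s.ι.app C).hom ⟨x, hC⟩ = (s.ι.app D).hom ⟨x, hD⟩ := by
  obtain ⟨E, hE, hE'⟩ := exists_ge_ge C D
  have h₁ := congr($(s.w (homOfLE hE)).hom ⟨x, hC⟩)
  have h₂ := congr($(s.w (homOfLE hE')).hom ⟨x, hD⟩)
  exact h₁.symm.trans h₂

/-- The morphism from an algebra induced by a cocone over its finitely generated subalgebras. -/
noncomputable def fgCoconeDesc (s : Cocone (fgDiagram B A)) : A →+* s.pt where
  toFun x := (s.ι.app (.adjoin {x})).hom ⟨x, FGSubalgebra.mem_adjoin (by simp)⟩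
  map_one' := (fgCocone_ι_eq s _ (one_mem (FGSubalgebra.adjoin {1}).1)).trans
    (map_one (s.ι.app (.adjoin {1})).hom)
  map_zero' := (fgCocone_ι_eq s _ (zero_mem (FGSubalgebra.adjoin {0}).1)).trans
    (map_zero (s.ι.app (.adjoin {0})).hom)
  map_add' x y := by
    classical
    have hx : x ∈ (FGSubalgebra.adjoin (B := B) {x, y}).1 := FGSubalgebra.mem_adjoin (by simp)
    have hy : y ∈ (FGSubalgebra.adjoin (B := B) {x, y}).1 := FGSubalgebra.mem_adjoin (by simp)
    rw [fgCocone_ι_eq s _ hx, fgCocone_ι_eq s _ hy, fgCocone_ι_eq s _ (add_mem hx hy)]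
    exact map_add (s.ι.app (.adjoin {x, y})).hom ⟨x, hx⟩ ⟨y, hy⟩
  map_mul' x y := by
    classical
    have hx : x ∈ (FGSubalgebra.adjoin (B := B) {x, y}).1 := FGSubalgebra.mem_adjoin (by simp)
    have hy : y ∈ (FGSubalgebra.adjoin (B := B) {x, y}).1 := FGSubalgebra.mem_adjoin (by simp)
    rw [fgCocone_ι_eq s _ hx, fgCocone_ι_eq s _ hy, fgCocone_ι_eq s _ (mul_mem hx hy)]
    exact map_mul (s.ι.app (.adjoin {x, y})).hom ⟨x, hx⟩ ⟨y, hy⟩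

variable (B A)

/-- An algebra is the colimit of its finitely generated subalgebras. -/
noncomputable def isColimitFgCocone : IsColimit (fgCocone B A) where
  desc s := CommRingCat.ofHom (fgCoconeDesc s)
  fac s C := by
    ext x
    exact fgCocone_ι_eq s _ x.2
  uniq s m hm := by
    ext x
    exact congr($(hm (.adjoin {x})).hom ⟨x, FGSubalgebra.mem_adjoin (Finset.mem_singleton_self _)⟩)

/-- The spectrum of an algebra is the limit of the spectra of its finitely generated
subalgebras. -/
noncomputable def isLimitSpecCone : IsLimit (specCone B A) :=
  isLimitOfPreserves Scheme.Spec (isColimitFgCocone B A).op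

/-- The structure morphism of the spectrum of a finitely generated subalgebra. -/
noncomputable def specDiagramBase (C : (FGSubalgebra B A)ᵒᵖ) :
    (specDiagram B A).obj C ⟶ Spec (CommRingCat.of B) :=
  Spec.map (CommRingCat.ofHom (algebraMap B C.unop.1))

theorem specDiagram_map_base {C D : (FGSubalgebra B A)ᵒᵖ} (a : C ⟶ D) :
    (specDiagram B A).map a ≫ specDiagramBase B A D = specDiagramBase B A C :=
  (Spec.map_comp _ _).symm

theorem specCone_π_base (C : (FGSubalgebra B A)ᵒᵖ) :
    (specCone B A).π.app C ≫ specDiagramBase B A C =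
      Spec.map (CommRingCat.ofHom (algebraMap B A)) :=
  (Spec.map_comp _ _).symm

instance (C : (FGSubalgebra B A)ᵒᵖ) : IsAffine ((specDiagram B A).obj C) :=
  inferInstanceAs (IsAffine (Spec _))

instance [IsNoetherianRing B] (C : (FGSubalgebra B A)ᵒᵖ) :
    IsNoetherian ((specDiagram B A).obj C) := by
  have := C.unop.1.fg_iff_finiteType.mp C.unop.2
  have : IsNoetherianRing C.unop.1 := Algebra.FiniteType.isNoetherianRing B _
  exact inferInstanceAs (IsNoetherian (Spec (CommRingCat.of C.unop.1)))

end FGSubalgebra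

section PurelyInseparable

open scoped TensorProduct

theorem pow_expChar_pow_injective_of_ringHom {L K : Type*} [CommRing L] [Field K] (φ : L →+* K)
    (q n : ℕ) [hq : ExpChar L q] : Function.Injective (fun x : K ↦ x ^ q ^ n) := by
  cases hq with
  | zero => exact fun x y h ↦ by simpa using h
  | prime hq =>
    have : CharP K q := (CharP.charP_iff_prime_eq_zero hq).mpr <| by
      rw [← map_natCast φ, CharP.cast_eq_zero, map_zero]
    have : Fact q.Prime := ⟨hq⟩
    exact iterateFrobenius_inj K q n

/-- A flat base change of an injective algebra generated by elements having a `q`-power in the base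
induces a universal homeomorphism on spectra, where `q` is the exponential characteristic. -/
theorem isUniversalHomeomorphism_SpecMap_includeRight {R C L : Type u} [CommRing R] [CommRing C]
    [CommRing L] [Algebra R C] [Algebra R L] [Module.Flat R L]
    (hC : Function.Injective (algebraMap R C)) (q : ℕ) [ExpChar L q] (s : Set C)
    (hs : Algebra.adjoin R s = ⊤) (h : ∀ x ∈ s, ∃ (n : ℕ) (b a : R), IsUnit (algebraMap R L b) ∧
      algebraMap R C b * x ^ q ^ n = algebraMap R C a) :
    IsUniversalHomeomorphism (Spec.map (CommRingCat.ofHom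
      (Algebra.TensorProduct.includeRight : L →ₐ[R] C ⊗[R] L).toRingHom)) := by
  have hq : q ≠ 0 := expChar_ne_zero L q
  have key : ∀ x ∈ s, ∃ (n : ℕ) (y : L), (x ^ q ^ n) ⊗ₜ[R] (1 : L) = 1 ⊗ₜ y := by
    intro x hx
    obtain ⟨n, b, a, ⟨u, hu⟩, hab⟩ := h x hx
    refine ⟨n, u⁻¹.1 * algebraMap R L a, ?_⟩
    calc (x ^ q ^ n) ⊗ₜ[R] (1 : L) = (x ^ q ^ n) ⊗ₜ[R] (b • (u⁻¹ : Lˣ).1) := by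
          rw [Algebra.smul_def, ← hu, u.mul_inv]
      _ = (algebraMap R C a) ⊗ₜ[R] (u⁻¹ : Lˣ).1 := by
          rw [← TensorProduct.smul_tmul, Algebra.smul_def, hab]
      _ = _ := by
          rw [Algebra.algebraMap_eq_smul_one, TensorProduct.smul_tmul, mul_comm, Algebra.smul_def]
  have h_integral : (Algebra.TensorProduct.includeRight : L →ₐ[R] C ⊗[R] L).toRingHom.IsIntegral := by
    intro z
    induction z using TensorProduct.induction_on with
    | zero => exact RingHom.isIntegralElem_zero _
    | add x y hx hy => exact hx.add _ hy
    | tmul x l =>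
      rw [show x ⊗ₜ[R] l = x ⊗ₜ[R] 1 * 1 ⊗ₜ[R] l by simp]
      refine RingHom.IsIntegralElem.mul _ ?_ (RingHom.isIntegralElem_map
        (Algebra.TensorProduct.includeRight : L →ₐ[R] C ⊗[R] L).toRingHom)
      have hx : x ∈ Algebra.adjoin R s := hs ▸ Algebra.mem_top
      induction hx using Algebra.adjoin_induction with
      | mem x hx =>
        obtain ⟨n, y, hy⟩ := key x hx
        let := (Algebra.TensorProduct.includeRight : L →ₐ[R] C ⊗[R] L).toRingHom.toAlgebra
        refine IsIntegral.of_pow (R := L) (n := q ^ n) (by positivity) ?_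
        rw [Algebra.TensorProduct.tmul_pow, one_pow, hy]
        exact RingHom.isIntegralElem_map
          (Algebra.TensorProduct.includeRight : L →ₐ[R] C ⊗[R] L).toRingHom
      | algebraMap r =>
        rw [Algebra.algebraMap_eq_smul_one, TensorProduct.smul_tmul]
        exact RingHom.isIntegralElem_map
          (Algebra.TensorProduct.includeRight : L →ₐ[R] C ⊗[R] L).toRingHom
      | add x y _ _ hx hy => rw [TensorProduct.add_tmul]; exact hx.add _ hy
      | mul x y _ _ hx hy =>
        rw [show (x * y) ⊗ₜ[R] (1 : L) = x ⊗ₜ[R] 1 * y ⊗ₜ[R] 1 by simp]; exact hx.mul _ hy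
  have : IsIntegralHom (Spec.map (CommRingCat.ofHom
      (Algebra.TensorProduct.includeRight : L →ₐ[R] C ⊗[R] L).toRingHom)) :=
    IsIntegralHom.SpecMap_iff.mpr h_integral
  have : Surjective (Spec.map (CommRingCat.ofHom
      (Algebra.TensorProduct.includeRight : L →ₐ[R] C ⊗[R] L).toRingHom)) :=
    ⟨h_integral.comap_surjective (Algebra.TensorProduct.includeRight_injective hC)⟩
  have hext (K : Type u) [Field K] (u v : C ⊗[R] L →+* K)
      (huv : ∀ l : L, u (1 ⊗ₜ l) = v (1 ⊗ₜ l)) : u = v := by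
    refine RingHom.ext fun z ↦ ?_
    induction z using TensorProduct.induction_on with
    | zero => rw [map_zero, map_zero]
    | add x y hx hy => rw [map_add, map_add, hx, hy]
    | tmul x l =>
      rw [show x ⊗ₜ[R] l = x ⊗ₜ[R] 1 * 1 ⊗ₜ[R] l by simp, map_mul, map_mul, huv]
      congr 1
      have hx : x ∈ Algebra.adjoin R s := hs ▸ Algebra.mem_top
      induction hx using Algebra.adjoin_induction with
      | mem x hx =>
        obtain ⟨n, y, hy⟩ := key x hx
        refine pow_expChar_pow_injective_of_ringHom (u.comp
          (Algebra.TensorProduct.includeRight : L →ₐ[R] C ⊗[R] L).toRingHom) q n ?_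
        dsimp only
        rw [← map_pow, ← map_pow, Algebra.TensorProduct.tmul_pow, one_pow, hy, huv]
      | algebraMap r => rw [Algebra.algebraMap_eq_smul_one, TensorProduct.smul_tmul, huv]
      | add x y _ _ hx hy => rw [TensorProduct.add_tmul, map_add, map_add, hx, hy]
      | mul x y _ _ hx hy =>
        rw [show (x * y) ⊗ₜ[R] (1 : L) = x ⊗ₜ[R] 1 * y ⊗ₜ[R] 1 by simp, map_mul, map_mul, hx, hy]
  have : UniversallyInjective (Spec.map (CommRingCat.ofHom
      (Algebra.TensorProduct.includeRight : L →ₐ[R] C ⊗[R] L).toRingHom)) := by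
    refine ((tfae_universallyInjective _).out 0 1).mpr ?_
    intro K _ u v huv
    obtain ⟨u, rfl⟩ := Spec.map_surjective u
    obtain ⟨v, rfl⟩ := Spec.map_surjective v
    dsimp only at huv
    rw [← Spec.map_comp, ← Spec.map_comp, Spec.map_inj] at huv
    have := hext K u.hom v.hom fun l ↦ congr($(huv).hom l)
    rw [CommRingCat.hom_ext this]
  exact .mk' _

theorem exists_isUniversalHomeomorphism_specDiagramBase {B F : Type u} [CommRing B] [IsDomain B]
    [Field F] [Algebra B F] [Algebra (FractionRing B) F] [IsScalarTower B (FractionRing B) F]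
    [IsPurelyInseparable (FractionRing B) F] (C : (FGSubalgebra B F)ᵒᵖ) :
    ∃ U : (Spec (CommRingCat.of B)).Opens, (U : Set (Spec (CommRingCat.of B))).Nonempty ∧
      IsUniversalHomeomorphism (pullback.snd (specDiagramBase B F C) U.ι) := by
  obtain ⟨q, _⟩ := ExpChar.exists B
  have : ExpChar (FractionRing B) q :=
    expChar_of_injective_ringHom (IsFractionRing.injective B (FractionRing B)) q
  have hF : Function.Injective (algebraMap B F) := by
    rw [IsScalarTower.algebraMap_eq B (FractionRing B) F]
    exact (algebraMap (FractionRing B) F).injective.comp (IsFractionRing.injective B _)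
  have hx (x : F) : ∃ (n : ℕ) (b a : B), b ≠ 0 ∧
      algebraMap B F b * x ^ q ^ n = algebraMap B F a := by
    obtain ⟨n, y, hy⟩ := IsPurelyInseparable.pow_mem (FractionRing B) q x
    obtain ⟨a, b, hb, rfl⟩ := IsFractionRing.div_surjective (A := B) y
    have hb : b ≠ 0 := nonZeroDivisors.ne_zero hb
    refine ⟨n, b, a, hb, ?_⟩
    have : algebraMap B F b ≠ 0 := (map_ne_zero_iff _ hF).mpr hb
    rw [← hy, map_div₀, ← IsScalarTower.algebraMap_apply, ← IsScalarTower.algebraMap_apply,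
      mul_div_cancel₀ _ this]
  choose n b a hb hab using hx
  obtain ⟨s, hs⟩ := (Subalgebra.fg_top C.unop.1).mpr C.unop.2
  let d : B := ∏ x ∈ s, b x
  have hd : d ≠ 0 := Finset.prod_ne_zero_iff.mpr fun x _ ↦ hb x
  let L := Localization.Away d
  have hL : Function.Injective (algebraMap B L) :=
    IsLocalization.injective L (powers_le_nonZeroDivisors_of_noZeroDivisors hd)
  have : ExpChar L q := expChar_of_injective_ringHom hL q
  have hC : Function.Injective (algebraMap B C.unop.1) :=
    .of_comp (f := algebraMap C.unop.1 F) <| by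
      rwa [← RingHom.coe_comp, ← IsScalarTower.algebraMap_eq]
  have : Module.Flat B L := IsLocalization.flat L (Submonoid.powers d)
  have H := isUniversalHomeomorphism_SpecMap_includeRight (L := L) hC q _ hs fun x hx ↦
    ⟨n x, b x, a x, isUnit_of_dvd_unit (map_dvd _ (Finset.dvd_prod_of_mem (fun x : C.unop.1 ↦ b x) hx))
      (IsLocalization.Away.algebraMap_isUnit d), Subtype.ext (hab x)⟩
  let j : Spec (CommRingCat.of L) ⟶ Spec (CommRingCat.of B) :=
    Spec.map (CommRingCat.ofHom (algebraMap B L))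
  have : Nonempty (Spec (CommRingCat.of L)) :=
    have : Nontrivial L := hL.nontrivial
    inferInstanceAs (Nonempty (PrimeSpectrum L))
  refine ⟨j.opensRange, Set.range_nonempty _, ?_⟩
  have H₁ := isPullback_SpecMap_of_isPushout _ _ _ _
    (CommRingCat.isPushout_tensorProduct B C.unop.1 L)
  have H₂ : IsPullback (pullback.fst (specDiagramBase B F C) j.opensRange.ι)
      (pullback.snd (specDiagramBase B F C) j.opensRange.ι) (specDiagramBase B F C)
      (j.isoOpensRange.inv ≫ j) := by
    rw [j.isoOpensRange_inv_comp]
    exact IsPullback.of_hasPullback _ _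
  exact H.of_isPullback (H₂.of_right' H₁)

end PurelyInseparable

section Spreading

namespace CartesianSystem

variable {I : Type u} [Category.{u} I] {D : I ⥤ Scheme.{u}} {S X Z : Scheme.{u}}
  (t : ∀ i, D.obj i ⟶ S) (ht : ∀ {i j : I} (a : i ⟶ j), D.map a ≫ t j = t i)
  (f : X ⟶ S) (p : Z ⟶ S) (c : Cone D) (r : c.pt ⟶ S) (hr : ∀ i, c.π.app i ≫ t i = r)

theorem isNoetherian_pullbackDiagram [∀ i, IsNoetherian (D.obj i)] [LocallyOfFiniteType f]
    [QuasiCompact f] (i : I) : IsNoetherian ((pullbackDiagram t ht f).obj i) := by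
  have : IsLocallyNoetherian (pullback f (t i)) :=
    LocallyOfFiniteType.isLocallyNoetherian (pullback.snd f (t i))
  have : CompactSpace ↥(pullback f (t i)) :=
    (inferInstance : QuasiCompact (pullback.snd f (t i))).compactSpace_of_compactSpace
  exact { toIsLocallyNoetherian := ‹_›, toCompactSpace := ‹_› }

include hr in
/-- A morphism over the limit of a diagram spreads out to one over some object of the diagram. -/
theorem exists_hom_pullbackDiagram [IsCofiltered I] (hc : IsLimit c)
    [∀ {i j : I} (a : i ⟶ j), IsAffineHom (D.map a)] [∀ i, IsNoetherian (D.obj i)]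
    [LocallyOfFiniteType f] [QuasiCompact f] [LocallyOfFinitePresentation p]
    (g : pullback f r ⟶ pullback p r) (hg : g ≫ pullback.snd p r = pullback.snd f r) :
    ∃ (i : I) (g' : (pullbackDiagram t ht f).obj i ⟶ (pullbackDiagram t ht p).obj i),
      g' ≫ pullbackDiagramSnd t ht p i = pullbackDiagramSnd t ht f i ∧
      pullbackDiagramConeπ t ht f c r hr i ≫ g' = g ≫ pullbackDiagramConeπ t ht p c r hr i := by
  have : IsConnected I := IsCofiltered.isConnected I
  let E := pullbackSystem t ht f c r hr hc
  have := @E.isAffineHom_map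
  have {i j : I} (a : i ⟶ j) : IsAffineHom ((pullbackDiagram t ht f).map a) := this a
  have := isNoetherian_pullbackDiagram t ht f
  obtain ⟨i, g₀, hg₀, hg₀'⟩ := Scheme.exists_π_app_comp_eq_of_locallyOfFinitePresentation
    (pullbackDiagram t ht f)
    { app i := pullbackDiagramSnd t ht f i ≫ t i
      naturality i j a := by
        rw [← Category.assoc, pullbackDiagram_map_snd, Category.assoc, ht]
        exact (Category.comp_id _).symm } p
    (pullbackDiagramCone t ht f c r hr) E.isLimit (g ≫ pullback.fst p r) (by
      ext i : 2
      change pullbackDiagramConeπ t ht f c r hr i ≫ pullbackDiagramSnd t ht f i ≫ t i =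
        (g ≫ pullback.fst p r) ≫ p
      rw [← Category.assoc, pullbackDiagramConeπ_snd, Category.assoc, hr, Category.assoc,
        pullback.condition, ← hg, Category.assoc])
  have H := isPullback_pullbackDiagram t ht p i
  refine ⟨i, H.lift g₀ (pullbackDiagramSnd t ht f i) hg₀', H.lift_snd _ _ _, H.hom_ext ?_ ?_⟩
  · rw [Category.assoc, H.lift_fst, Category.assoc, pullbackDiagramConeπ_fst]
    exact hg₀
  · rw [Category.assoc, H.lift_snd, Category.assoc, pullbackDiagramConeπ_snd,
      pullbackDiagramConeπ_snd, ← hg, Category.assoc]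

include hr in
theorem exists_isUniversalHomeomorphism_pullbackDiagram [IsCofiltered I] (hc : IsLimit c)
    [∀ {i j : I} (a : i ⟶ j), IsAffineHom (D.map a)] [∀ i, IsNoetherian (D.obj i)]
    [LocallyOfFiniteType f] [QuasiCompact f] [IsSeparated f]
    [LocallyOfFinitePresentation p] [QuasiCompact p] [IsSeparated p]
    (g : pullback f r ⟶ pullback p r) (hg : g ≫ pullback.snd p r = pullback.snd f r)
    (hgu : IsUniversalHomeomorphism g) :
    ∃ (i : I) (g' : (pullbackDiagram t ht f).obj i ⟶ (pullbackDiagram t ht p).obj i),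
      g' ≫ pullbackDiagramSnd t ht p i = pullbackDiagramSnd t ht f i ∧
      IsUniversalHomeomorphism g' := by
  obtain ⟨i, h, hh, hgh⟩ := exists_hom_pullbackDiagram t ht f p c r hr hc g hg
  have : IsConnected I := IsCofiltered.isConnected I
  let E := pullbackSystem t ht p c r hr hc
  have hE := @E.isAffineHom_map
  let t' (k : Over i) :
      (Over.forget i ⋙ pullbackDiagram t ht p).obj k ⟶ (pullbackDiagram t ht p).obj i :=
    (pullbackDiagram t ht p).map k.hom
  have (k : Over i) : IsAffineHom (t' k) := hE k.hom
  have {k l : Over i} (a : k ⟶ l) :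
      IsAffineHom ((Over.forget i ⋙ pullbackDiagram t ht p).map a) := hE a.left
  have := isNoetherian_pullbackDiagram t ht p
  have (k : Over i) : IsNoetherian ((Over.forget i ⋙ pullbackDiagram t ht p).obj k) := this k.left
  have : IsConnected (Over i) := IsCofiltered.isConnected _
  have H : IsPullback (pullbackDiagramConeπ t ht f c r hr i) g h
      (pullbackDiagramConeπ t ht p c r hr i) :=
    IsPullback.of_bot (by rw [hg, hh]; exact isPullback_pullbackDiagramConeπ t ht f c r hr i) hgh
      (isPullback_pullbackDiagramConeπ t ht p c r hr i)
  have : IsSeparated (h ≫ pullbackDiagramSnd t ht p i) :=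
    hh ▸ inferInstanceAs (IsSeparated (pullback.snd f (t i)))
  have : LocallyOfFiniteType (h ≫ pullbackDiagramSnd t ht p i) :=
    hh ▸ inferInstanceAs (LocallyOfFiniteType (pullback.snd f (t i)))
  have : QuasiCompact (h ≫ pullbackDiagramSnd t ht p i) :=
    hh ▸ inferInstanceAs (QuasiCompact (pullback.snd f (t i)))
  have : IsSeparated (pullbackDiagramSnd t ht p i) :=
    inferInstanceAs (IsSeparated (pullback.snd p (t i)))
  have : IsSeparated h := .of_comp h (pullbackDiagramSnd t ht p i)
  have : LocallyOfFiniteType h :=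
    locallyOfFiniteType_of_comp h (pullbackDiagramSnd t ht p i)
  have : QuasiCompact h := .of_comp h (pullbackDiagramSnd t ht p i)
  have H₀ : IsUniversalHomeomorphism (pullback.snd h (pullbackDiagramConeπ t ht p c r hr i)) := by
    rw [← H.isoPullback_inv_snd]
    exact .comp (.mk' _) hgu
  obtain ⟨k, hk⟩ := exists_isUniversalHomeomorphism_snd
    (D := Over.forget i ⋙ pullbackDiagram t ht p)
    t'
    (fun a ↦ ((pullbackDiagram t ht p).map_comp _ _).symm.trans
      congr((pullbackDiagram t ht p).map $(Over.w a))) h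
    ((pullbackDiagramCone t ht p c r hr).whisker (Over.forget i))
    (pullbackDiagramConeπ t ht p c r hr i)
    (fun k ↦ (pullbackDiagramCone t ht p c r hr).w k.hom)
    ((Functor.Initial.isLimitWhiskerEquiv (Over.forget i) _).symm E.isLimit)
    H₀
  have H₁ := isPullback_pullbackDiagram_map t ht p k.hom
  have H₂ := isPullback_pullbackDiagram_map t ht f k.hom
  have w : ((pullbackDiagram t ht f).map k.hom ≫ h) ≫ pullbackDiagramSnd t ht p i =
      pullbackDiagramSnd t ht f k.left ≫ D.map k.hom := by
    rw [Category.assoc, hh, H₂.w]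
  refine ⟨k.left, H₁.lift ((pullbackDiagram t ht f).map k.hom ≫ h)
    (pullbackDiagramSnd t ht f k.left) w, H₁.lift_snd _ _ _, ?_⟩
  have H₃ : IsPullback ((pullbackDiagram t ht f).map k.hom) (H₁.lift _ _ w) h
      ((pullbackDiagram t ht p).map k.hom) :=
    IsPullback.of_bot (by rw [hh, H₁.lift_snd]; exact H₂) (H₁.lift_fst _ _ _).symm H₁
  rw [← H₃.isoPullback_hom_snd]
  exact .comp (.mk' _) hk

end CartesianSystem

end Spreading

theorem IsUniversalHomeomorphism.exists_of_isPullback {S X D V U P P' Q : Scheme.{u}} {h : X ⟶ S}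
    {t : D ⟶ S} {v : U ⟶ S} {pX : P ⟶ X} {pD : P ⟶ D} {qX : Q ⟶ X} {qU : Q ⟶ U}
    {d : V ⟶ D} {e : V ⟶ U} (H₁ : IsPullback pX pD h t) (H₂ : IsPullback qX qU h v)
    (H : d ≫ t = e ≫ v) (he : IsUniversalHomeomorphism e) {g : P' ⟶ P} {pD' : P' ⟶ D}
    (hg : IsUniversalHomeomorphism g) (hgp : g ≫ pD = pD') :
    ∃ a : pullback pD' d ⟶ Q, IsUniversalHomeomorphism a ∧ a ≫ qU = pullback.snd pD' d ≫ e := by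
  subst hgp
  have H₃ := (IsPullback.of_hasPullback pD d).paste_horiz H₁
  rw [H] at H₃
  have H₄ := H₃.of_right' H₂
  have H₅ := (IsPullback.of_hasPullback (g ≫ pD) d).of_bot' (IsPullback.of_hasPullback pD d)
  refine ⟨_, (hg.of_isPullback H₅).comp (he.of_isPullback H₄.flip), ?_⟩
  rw [Category.assoc, H₂.lift_snd, ← Category.assoc, IsPullback.lift_snd]

/-- `S` is Noetherian, `Y = Spec B` is an affine integral separated
`S`-scheme of finite type (so `B` is a domain), `X`, `Z` are separated `S`-schemes of
finite type, `f : X ⟶ Y` is an `S`-morphism, `F` is the perfect closure of `Frac B`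
(a perfect, purely inseparable field extension of `Frac B`), and there is a universal
homeomorphism of `F`-schemes `g : X ×_Y Spec F ⟶ Z ×_S Spec F`.  Then there are a
nonempty open `U ⊆ Y`, a scheme `T` and universal homeomorphisms of `S`-schemes
`a : T ⟶ X ×_Y U` and `b : T ⟶ Z ×_S U`. -/
theorem statement5 (S : Scheme) [IsNoetherian S]
    (B : Type) [CommRing B] [IsDomain B]
    (X Z : Scheme)
    (sY : Spec (CommRingCat.of B) ⟶ S)
    [LocallyOfFiniteType sY] [QuasiCompact sY] [IsSeparated sY]
    (sX : X ⟶ S) [LocallyOfFiniteType sX] [QuasiCompact sX] [IsSeparated sX]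
    (sZ : Z ⟶ S) [LocallyOfFiniteType sZ] [QuasiCompact sZ] [IsSeparated sZ]
    (f : X ⟶ Spec (CommRingCat.of B)) (hf : f ≫ sY = sX)
    (F : Type) [Field F] [Algebra (FractionRing B) F]
    [PerfectField F] [IsPurelyInseparable (FractionRing B) F]
    (φ : Spec (CommRingCat.of F) ⟶ Spec (CommRingCat.of B))
    (hφ : φ = Spec.map (CommRingCat.ofHom
      ((algebraMap (FractionRing B) F).comp (algebraMap B (FractionRing B)))))
    (g : pullback f φ ⟶ pullback sZ (φ ≫ sY))
    (hg : g ≫ pullback.snd sZ (φ ≫ sY) = pullback.snd f φ)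
    (hguniv : IsUniversalHomeomorphism g) :
    ∃ U : (Spec (CommRingCat.of B)).Opens,
      (U : Set (Spec (CommRingCat.of B))).Nonempty ∧
      ∃ (T : Scheme) (a : T ⟶ pullback f U.ι) (b : T ⟶ pullback sZ (U.ι ≫ sY)),
        IsUniversalHomeomorphism a ∧ IsUniversalHomeomorphism b ∧
        a ≫ pullback.fst f U.ι ≫ sX = b ≫ pullback.fst sZ (U.ι ≫ sY) ≫ sZ := by
  let : Algebra B F :=
    ((algebraMap (FractionRing B) F).comp (algebraMap B (FractionRing B))).toAlgebra
  have : IsScalarTower B (FractionRing B) F := .of_algebraMap_eq' rfl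
  have : IsLocallyNoetherian (Spec (CommRingCat.of B)) :=
    LocallyOfFiniteType.isLocallyNoetherian sY
  have : IsNoetherianRing B := isLocallyNoetherian_Spec.mp this
  have : IsSeparated (f ≫ sY) := hf ▸ inferInstance
  have : LocallyOfFiniteType (f ≫ sY) := hf ▸ inferInstance
  have : QuasiCompact (f ≫ sY) := hf ▸ inferInstance
  have : IsSeparated f := .of_comp f sY
  have : LocallyOfFiniteType f := locallyOfFiniteType_of_comp f sY
  have : QuasiCompact f := .of_comp f sY
  let p := pullback.snd sZ sY
  have Hp := IsPullback.of_hasPullback sZ sY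
  have Hφ : IsPullback (pullback.fst p φ ≫ pullback.fst sZ sY) (pullback.snd p φ) sZ (φ ≫ sY) :=
    (IsPullback.of_hasPullback p φ).paste_horiz Hp
  have hr (C : (FGSubalgebra B F)ᵒᵖ) :
      (specCone B F).π.app C ≫ specDiagramBase B F C = φ :=
    (specCone_π_base B F C).trans hφ.symm
  have hgp : (g ≫ Hφ.isoPullback.inv) ≫ pullback.snd p φ = pullback.snd f φ := by
    rw [Category.assoc, Hφ.isoPullback_inv_snd, hg]
  have hgu : IsUniversalHomeomorphism (g ≫ Hφ.isoPullback.inv) := hguniv.comp (.mk' _)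
  obtain ⟨C, g', hg', hg'u⟩ := CartesianSystem.exists_isUniversalHomeomorphism_pullbackDiagram
    (specDiagramBase B F) (specDiagram_map_base B F) f p (specCone B F) φ hr
    (isLimitSpecCone B F) _ hgp hgu
  obtain ⟨U, hU, he⟩ := exists_isUniversalHomeomorphism_specDiagramBase C
  have H := pullback.condition (f := specDiagramBase B F C) (g := U.ι)
  obtain ⟨a, ha, ha'⟩ := IsUniversalHomeomorphism.exists_of_isPullback
    (isPullback_pullbackDiagram (specDiagramBase B F) (specDiagram_map_base B F) f C)
    (IsPullback.of_hasPullback f U.ι) H he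
    (.mk' (𝟙 _)) (Category.id_comp _)
  obtain ⟨b, hb, hb'⟩ := IsUniversalHomeomorphism.exists_of_isPullback
    (isPullback_pullbackDiagram (specDiagramBase B F) (specDiagram_map_base B F) p C)
    ((IsPullback.of_hasPullback sZ (U.ι ≫ sY)).of_right' Hp) H he hg'u hg'
  refine ⟨U, hU, _, a, b, ha, hb, ?_⟩
  rw [pullback.condition, ← Category.assoc b, hb', ← hf, pullback.condition_assoc,
    ← Category.assoc a, ha']
end

section
/- Let F be a field, let m and n be natural numbers, let C be a constructible subset of 𝔸^m_F and E a constructible subset of 𝔸^{m+n}_F, and let π : 𝔸^{m+n}_F → 𝔸^m_F denote the projection onto the first m coordinates. Assume that for every algebraically closed field L containing F, the subset E(L) of L^{m+n} is the graph of a function whose domain of definition is C(L) ⊆ L^m. Then there exist a finite partition U_1, …, U_r of C into locally closed subsets of 𝔸^m_F such that, setting V_i := E ∩ π^{-1}(U_i), the sets V_1, …, V_r form a partition of E into locally closed subsets of 𝔸^{m+n}_F and, for every i, the morphism V_i → U_i induced by π, where U_i and V_i carry their reduced induced subscheme structures, is a universal homeomorphism. -/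
open CategoryTheory AlgebraicGeometry CategoryTheory.Limits

/-- A constructible subset of a topological space: a finite union of locally
closed subsets. -/
def IsConstructibleSet {α : Type*} [TopologicalSpace α] (s : Set α) : Prop :=
  ∃ (k : ℕ) (t : Fin k → Set α), (∀ i, IsLocallyClosed (t i)) ∧ s = ⋃ i, t i

/-- Affine `r`-space over the field `F`, as the spectrum of a polynomial ring. -/
noncomputable abbrev AffSp (F : Type) [Field F] (r : ℕ) : Scheme :=
  Spec (CommRingCat.of (MvPolynomial (Fin r) F))

/-- The projection `𝔸^{m+n}_F ⟶ 𝔸^m_F` onto the first `m` coordinates. -/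
noncomputable def projAff (F : Type) [Field F] (m n : ℕ) :
    AffSp F (m + n) ⟶ AffSp F m :=
  Spec.map (CommRingCat.ofHom
    (MvPolynomial.rename (Fin.castAdd n) : MvPolynomial (Fin m) F →ₐ[F] _).toRingHom)

/-- The point of affine `r`-space over `F` corresponding to the coordinate tuple
`a : Fin r → L`, for `L` a field extension of `F`: the image of the induced morphism
`Spec L ⟶ 𝔸^r_F`, i.e. the kernel of the evaluation map at `a`. -/
noncomputable def ptOf (F : Type) [Field F] (r : ℕ) (L : Type) [Field L] [Algebra F L]
    (a : Fin r → L) : AffSp F r :=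
  (⟨RingHom.ker (MvPolynomial.aeval a).toRingHom,
    RingHom.ker_isPrime _⟩ : PrimeSpectrum (MvPolynomial (Fin r) F))

/-- `D(L)`: the set of tuples `a ∈ L^r` whose associated point of `𝔸^r_F` lies in `D`. -/
noncomputable def Lpoints (F : Type) [Field F] (r : ℕ) (D : Set (AffSp F r))
    (L : Type) [Field L] [Algebra F L] : Set (Fin r → L) :=
  {a | ptOf F r L a ∈ D}

lemma IsConstructibleSet.isConstructible {X : Type*} [TopologicalSpace X]
    [TopologicalSpace.NoetherianSpace X] {s : Set X} (hs : IsConstructibleSet s) :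
    Topology.IsConstructible s := by
  have key : ∀ U : Set X, IsOpen U → Topology.IsConstructible U := fun U hU ↦
    IsRetrocompact.isConstructible hU fun V _ _ ↦ TopologicalSpace.NoetherianSpace.isCompact _
  obtain ⟨k, t, ht, rfl⟩ := hs
  refine .iUnion fun i ↦ ?_
  obtain ⟨U, Z, hU, hZ, h⟩ := ht i
  rw [h]
  exact (key U hU).inter (Topology.isConstructible_compl.mp (key _ hZ.isOpen_compl))

/-- A constructible set either contains or misses a neighbourhood of `x` in `closure {x}`. -/
lemma Topology.IsConstructible.exists_isOpen_inter_closure_singleton {X : Type*}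
    [TopologicalSpace X] {s : Set X} (hs : Topology.IsConstructible s) (x : X) :
    ∃ W, IsOpen W ∧ x ∈ W ∧ (W ∩ closure {x} ⊆ s ∨ W ∩ closure {x} ⊆ sᶜ) := by
  induction hs using Topology.IsConstructible.empty_union_induction with
  | open_retrocompact U hU _ =>
    by_cases hx : x ∈ U
    · exact ⟨U, hU, hx, .inl Set.inter_subset_left⟩
    · refine ⟨Set.univ, isOpen_univ, trivial, .inr ?_⟩
      rw [Set.univ_inter]
      exact closure_minimal (by simpa using hx) hU.isClosed_compl
  | union s _ t _ ihs iht =>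
    obtain ⟨V, hV, hxV, h⟩ := ihs
    obtain ⟨W, hW, hxW, h'⟩ := iht
    refine ⟨V ∩ W, hV.inter hW, ⟨hxV, hxW⟩, ?_⟩
    obtain h | h := h
    · exact .inl fun y hy ↦ .inl (h ⟨hy.1.1, hy.2⟩)
    obtain h' | h' := h'
    · exact .inl fun y hy ↦ .inr (h' ⟨hy.1.2, hy.2⟩)
    · exact .inr fun y hy hy' ↦ hy'.elim (h ⟨hy.1.1, hy.2⟩) (h' ⟨hy.1.2, hy.2⟩)
  | compl s _ ih =>
    obtain ⟨V, hV, hxV, h⟩ := ih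
    exact ⟨V, hV, hxV, by rw [compl_compl]; exact h.symm⟩

lemma Topology.IsConstructible.exists_isOpen_inter_closure_singleton_subset {X : Type*}
    [TopologicalSpace X] {s : Set X} (hs : Topology.IsConstructible s) {x : X} (hx : x ∈ s) :
    ∃ W, IsOpen W ∧ x ∈ W ∧ W ∩ closure {x} ⊆ s := by
  obtain ⟨W, hW, hxW, h | h⟩ := hs.exists_isOpen_inter_closure_singleton x
  · exact ⟨W, hW, hxW, h⟩
  · exact absurd hx (h ⟨hxW, subset_closure rfl⟩)

/-- In a Noetherian sober space, every nonempty closed set `Z` contains a point whose closure is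
a neighbourhood of that point in `Z`. -/
lemma IsClosed.exists_isOpen_inter_subset_closure_singleton {X : Type*} [TopologicalSpace X]
    [TopologicalSpace.NoetherianSpace X] [QuasiSober X] {Z : Set X} (hZ : IsClosed Z)
    (hne : Z.Nonempty) :
    ∃ x ∈ Z, ∃ W, IsOpen W ∧ x ∈ W ∧ W ∩ Z ⊆ closure {x} := by
  have : TopologicalSpace.NoetherianSpace Z :=
    Topology.IsInducing.subtypeVal.noetherianSpace
  have : QuasiSober Z := hZ.isClosedEmbedding_subtypeVal.quasiSober
  obtain ⟨z, hz⟩ := hne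
  let I := irreducibleComponent (⟨z, hz⟩ : Z)
  have hI : I ∈ irreducibleComponents Z := irreducibleComponent_mem_irreducibleComponents _
  obtain ⟨o, ho, ⟨y, hy⟩, hoI⟩ :=
    TopologicalSpace.NoetherianSpace.exists_isOpen_nonempty_subset_irreducibleComponent I hI
  obtain ⟨x, hx⟩ := QuasiSober.sober hI.1 isClosed_irreducibleComponent
  obtain ⟨W, hW, rfl⟩ := isOpen_induced_iff.mp ho
  have hxo : x ∈ Subtype.val ⁻¹' W := by
    have : y ∈ closure {x} := hx.symm ▸ hoI hy
    exact (specializes_iff_mem_closure.mpr this).mem_open ho hy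
  refine ⟨x, x.2, W, hW, hxo, fun w hw ↦ ?_⟩
  have : (⟨w, hw.2⟩ : Z) ∈ closure {x} := hx.symm ▸ hoI hw.1
  simpa [closure_subtype] using this

/-- Noetherian induction: if locally around each point `x` of `closure {x}` the set `C` is
either empty or everything with property `G`, then `C` has a finite partition into sets with
property `G`. -/
lemma exists_finset_pairwiseDisjoint_sUnion_eq {X : Type*} [TopologicalSpace X]
    [TopologicalSpace.NoetherianSpace X] [QuasiSober X] (C : Set X) (G : Set X → Prop)
    (H : ∀ x W, IsOpen W → x ∈ W → ∃ V ⊆ W, IsOpen V ∧ x ∈ V ∧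
      (V ∩ closure {x} ⊆ Cᶜ ∨ V ∩ closure {x} ⊆ C ∧ G (V ∩ closure {x}))) :
    ∃ S : Finset (Set X), (∀ s ∈ S, G s) ∧ ⋃₀ (S : Set (Set X)) = C ∧
      (S : Set (Set X)).PairwiseDisjoint id := by
  classical
  suffices ∀ Z : TopologicalSpace.Closeds X, ∃ S : Finset (Set X), (∀ s ∈ S, G s) ∧
      ⋃₀ (S : Set (Set X)) = C ∩ Z ∧ (S : Set (Set X)).PairwiseDisjoint id by
    simpa using this ⊤
  intro Z
  induction Z using WellFoundedLT.induction with
  | ind Z ih =>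
  obtain hZ | hZ := (Z : Set X).eq_empty_or_nonempty
  · exact ⟨∅, by simp, by simp [hZ], by simp⟩
  obtain ⟨x, hx, W, hW, hxW, hWZ⟩ :=
    Z.isClosed.exists_isOpen_inter_subset_closure_singleton hZ
  obtain ⟨V, hVW, hV, hxV, h⟩ := H x W hW hxW
  have hVZ : V ∩ closure {x} = V ∩ Z := by
    have : closure {x} ⊆ (Z : Set X) := closure_minimal (by simpa using hx) Z.isClosed
    ext y
    exact ⟨fun h ↦ ⟨h.1, this h.2⟩, fun h ↦ ⟨h.1, hWZ ⟨hVW h.1, h.2⟩⟩⟩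
  let Z' : TopologicalSpace.Closeds X := ⟨(Z : Set X) \ V, Z.isClosed.sdiff hV⟩
  have hlt : Z' < Z := by
    refine lt_of_le_of_ne (fun y hy ↦ hy.1) fun h ↦ ?_
    have : x ∈ Z' := h ▸ hx
    exact this.2 hxV
  obtain ⟨S, hS, hSC, hSd⟩ := ih Z' hlt
  have hZ' : (Z' : Set X) = (Z : Set X) \ V := rfl
  rw [hVZ] at h
  obtain h | ⟨h, hG⟩ := h
  · refine ⟨S, hS, ?_, hSd⟩
    rw [hSC, hZ']
    clear * - h
    ext y
    have : y ∈ V → y ∈ Z → y ∉ C := fun h₁ h₂ ↦ h ⟨h₁, h₂⟩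
    simp only [Set.mem_inter_iff, Set.mem_sdiff, SetLike.mem_coe]
    tauto
  · refine ⟨insert (V ∩ Z) S, by simpa using ⟨hG, hS⟩, ?_, ?_⟩
    · rw [Finset.coe_insert, Set.sUnion_insert, hSC, hZ']
      clear * - h
      ext y
      have : y ∈ V → y ∈ Z → y ∈ C := fun h₁ h₂ ↦ h ⟨h₁, h₂⟩
      simp only [Set.mem_inter_iff, Set.mem_sdiff, SetLike.mem_coe, Set.mem_union]
      tauto
    · rw [Finset.coe_insert]
      refine hSd.insert fun s hs _ ↦ ?_
      have : s ⊆ C ∩ ((Z : Set X) \ V) := hZ' ▸ hSC ▸ Set.subset_sUnion_of_mem hs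
      exact Set.disjoint_left.mpr fun y hy hys ↦ (this hys).2.2 hy.1

lemma IsUniversalHomeomorphism.of_universallyClosed {X Y : Scheme} (f : X ⟶ Y)
    [UniversallyClosed f] [UniversallyInjective f] [Surjective f] :
    IsUniversalHomeomorphism f := by
  intro X' Y' i₁ i₂ f' h
  have h₁ : UniversallyClosed f' := MorphismProperty.of_isPullback h.flip ‹_›
  have h₂ : UniversallyInjective f' := MorphismProperty.of_isPullback h.flip ‹_›
  have h₃ : Surjective f' := MorphismProperty.of_isPullback h.flip ‹_›
  exact isHomeomorph_iff_continuous_isClosedMap_bijective.mpr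
    ⟨f'.continuous, f'.isClosedMap, f'.injective, f'.surjective⟩

lemma Localization.awayMap_algebraMap {R S : Type*} [CommRing R] [CommRing S] (f : R →+* S)
    (h x : R) : Localization.awayMap f h (algebraMap R _ x) = algebraMap S _ (f x) := by
  simp [IsLocalization.Away.map]

/-- A generically algebraic extension of finite type is integral after inverting a suitable
nonzero element of the base. -/
lemma Algebra.FiniteType.exists_forall_isIntegral_awayMap (R S : Type*) [CommRing R] [IsDomain R]
    [CommRing S] [Algebra R S] [Algebra.FiniteType R S] [Algebra.IsAlgebraic R S] :
    ∃ r : R, r ≠ 0 ∧ ∀ h, r ∣ h → (Localization.awayMap (algebraMap R S) h).IsIntegral := by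
  obtain ⟨t, ht⟩ := Algebra.FiniteType.out (R := R) (A := S)
  obtain ⟨r, hr0, hr⟩ := Algebra.IsAlgebraic.exists_integral_multiples R t
  refine ⟨r, hr0, fun h ⟨k, hk⟩ ↦ ?_⟩
  let g := Localization.awayMap (algebraMap R S) h
  have hg (x : R) : g (algebraMap R _ x) = algebraMap S _ (algebraMap R S x) :=
    Localization.awayMap_algebraMap _ _ _
  let u : Localization.Away h := IsLocalization.Away.invSelf h
  have hu : g u * algebraMap S _ (algebraMap R S h) = 1 := by
    rw [← hg, ← map_mul, mul_comm, IsLocalization.Away.mul_invSelf, map_one]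
  let I : Subalgebra R S :=
    { carrier := {s | g.IsIntegralElem (algebraMap S _ s)}
      mul_mem' := fun ha hb ↦ by
        simpa using RingHom.IsIntegralElem.mul g ha hb
      add_mem' := fun ha hb ↦ by
        simpa using RingHom.IsIntegralElem.add g ha hb
      algebraMap_mem' := fun x ↦ by
        change g.IsIntegralElem _
        rw [← hg]
        exact g.isIntegralElem_map }
  have hI : I = ⊤ := by
    rw [← top_le_iff, ← ht]
    refine Algebra.adjoin_le fun s hs ↦ ?_
    obtain ⟨p, hp, hps⟩ := hr s hs
    have h₁ : g.IsIntegralElem (algebraMap S _ (r • s)) := by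
      refine ⟨p.map (algebraMap R _), hp.map _, ?_⟩
      have : g.comp (algebraMap R _) = (algebraMap S _).comp (algebraMap R S) := RingHom.ext hg
      rw [Polynomial.eval₂_map, this, ← Polynomial.hom_eval₂, hps, map_zero]
    have h₂ : algebraMap S (Localization.Away (algebraMap R S h)) s =
        g (u * algebraMap R _ k) * algebraMap S _ (r • s) := by
      calc _ = g u * algebraMap S _ (algebraMap R S h) * algebraMap S _ s := by rw [hu, one_mul]
        _ = _ := by
          simp only [map_mul, hg, hk, Algebra.smul_def]
          ring
    change g.IsIntegralElem _
    rw [h₂]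
    exact RingHom.IsIntegralElem.mul g g.isIntegralElem_map h₁
  intro x
  obtain ⟨n, s, hs⟩ := IsLocalization.Away.surj (algebraMap R S h) x
  have : x = g (u ^ n) * algebraMap S _ s := by
    rw [← hs, map_pow, mul_left_comm, ← mul_pow, hu, one_pow, mul_one]
  rw [this]
  exact RingHom.IsIntegralElem.mul g g.isIntegralElem_map (hI ▸ Algebra.mem_top : s ∈ I)

/-- An extension `M / K` of fields any two of whose embeddings into the same algebraically closed
field coincide is algebraic. -/
lemma Algebra.IsAlgebraic.of_forall_algHom_eq (K M : Type*) [Field K] [Field M] [Algebra K M]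
    (H : ∀ f g : M →ₐ[K] AlgebraicClosure M, f = g) : Algebra.IsAlgebraic K M := by
  have : IsPurelyInseparable K M := (isPurelyInseparable_iff_subsingleton_emb K M).mpr ⟨H⟩
  infer_instance

/-- Two field extensions of the same field embed into a common algebraically closed field. -/
lemma exists_isAlgClosed_comp_algebraMap_eq (K M N : Type) [Field K] [Field M] [Field N]
    [Algebra K M] [Algebra K N] :
    ∃ (L : Type) (_ : Field L) (_ : IsAlgClosed L) (f : M →+* L) (g : N →+* L),
      f.comp (algebraMap K M) = g.comp (algebraMap K N) := by
  obtain ⟨I, hI⟩ := Ideal.exists_maximal (TensorProduct K M N)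
  let := Ideal.Quotient.field I
  let q := (algebraMap (TensorProduct K M N ⧸ I)
    (AlgebraicClosure (TensorProduct K M N ⧸ I))).comp (Ideal.Quotient.mk I)
  refine ⟨AlgebraicClosure (TensorProduct K M N ⧸ I), inferInstance, inferInstance,
    q.comp Algebra.TensorProduct.includeLeftRingHom,
    q.comp Algebra.TensorProduct.includeRight.toRingHom, ?_⟩
  ext x
  simp only [RingHom.comp_apply]
  congr 1
  simp [Algebra.TensorProduct.algebraMap_def, Algebra.TensorProduct.tmul_one_eq_one_tmul]

/-- The universally injective condition on a map of affine schemes in terms of ring maps to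
algebraically closed fields. -/
lemma universallyInjective_SpecMap {R S : Type} [CommRing R] [CommRing S] (f : R →+* S)
    (H : ∀ (L : Type) [Field L] [IsAlgClosed L] (u v : S →+* L), u.comp f = v.comp f → u = v) :
    UniversallyInjective (Spec.map (CommRingCat.ofHom f)) := by
  refine ((tfae_universallyInjective _).out 0 1).mpr ?_
  intro K _ g₁ g₂ h
  obtain ⟨u, rfl⟩ := Spec.map_surjective g₁
  obtain ⟨v, rfl⟩ := Spec.map_surjective g₂
  simp only [← Spec.map_comp] at h
  congr 1
  ext1
  let a := algebraMap K (AlgebraicClosure K)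
  have := H _ (a.comp u.hom) (a.comp v.hom) <| by
    rw [RingHom.comp_assoc, RingHom.comp_assoc]
    congr 1
    exact congrArg CommRingCat.Hom.hom (Spec.map_injective h)
  exact RingHom.ext fun x ↦ a.injective congr($this x)

/-- The sets `C ⊆ Spec A` and `E ⊆ Spec B` are such that, for every algebraically closed field `L`,
the `L`-points of `E` are the graph of a function on the `L`-points of `C`. -/
structure IsGeometricGraph {A B : Type} [CommRing A] [CommRing B] [Algebra A B]
    (C : Set (PrimeSpectrum A)) (E : Set (PrimeSpectrum B)) : Prop where
  mem {L : Type} [Field L] [IsAlgClosed L] (f : B →+* L) (hf : PrimeSpectrum.comap f ⊥ ∈ E) :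
    PrimeSpectrum.comap (f.comp (algebraMap A B)) ⊥ ∈ C
  eq {L : Type} [Field L] [IsAlgClosed L] (f g : B →+* L) (hf : PrimeSpectrum.comap f ⊥ ∈ E)
    (hg : PrimeSpectrum.comap g ⊥ ∈ E) (h : f.comp (algebraMap A B) = g.comp (algebraMap A B)) :
    f = g
  exists_lift {L : Type} [Field L] [IsAlgClosed L] (c : A →+* L)
    (hc : PrimeSpectrum.comap c ⊥ ∈ C) :
    ∃ f : B →+* L, PrimeSpectrum.comap f ⊥ ∈ E ∧ f.comp (algebraMap A B) = c

lemma PrimeSpectrum.comap_comp_algebraMap_residueField_bot {A L : Type*} [CommRing A] [Field L]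
    (x : PrimeSpectrum A) (f : x.asIdeal.ResidueField →+* L) :
    PrimeSpectrum.comap (f.comp (algebraMap A x.asIdeal.ResidueField)) ⊥ = x := by
  ext1
  change RingHom.ker _ = _
  rw [RingHom.ker_comp_of_injective _ f.injective, Ideal.ker_algebraMap_residueField]

namespace IsGeometricGraph

variable {A B : Type} [CommRing A] [CommRing B] [Algebra A B] {C : Set (PrimeSpectrum A)}
  {E : Set (PrimeSpectrum B)}

lemma mapsTo (hG : IsGeometricGraph C E) {e : PrimeSpectrum B} (he : e ∈ E) :
    PrimeSpectrum.comap (algebraMap A B) e ∈ C := by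
  let f := (algebraMap e.asIdeal.ResidueField (AlgebraicClosure e.asIdeal.ResidueField)).comp
    (algebraMap B _)
  have hf : PrimeSpectrum.comap f ⊥ = e :=
    PrimeSpectrum.comap_comp_algebraMap_residueField_bot e _
  have := hG.mem f (by rwa [hf])
  rwa [PrimeSpectrum.comap_comp_apply, hf] at this

lemma exists_mem (hG : IsGeometricGraph C E) {c : PrimeSpectrum A} (hc : c ∈ C) :
    ∃ e ∈ E, PrimeSpectrum.comap (algebraMap A B) e = c := by
  have h := PrimeSpectrum.comap_comp_algebraMap_residueField_bot c
    (algebraMap c.asIdeal.ResidueField (AlgebraicClosure c.asIdeal.ResidueField))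
  obtain ⟨f, hf, hfc⟩ := hG.exists_lift _ (by rwa [h])
  refine ⟨_, hf, ?_⟩
  rw [← PrimeSpectrum.comap_comp_apply, hfc, h]

lemma injOn (hG : IsGeometricGraph C E) :
    Set.InjOn (PrimeSpectrum.comap (algebraMap A B)) E := by
  intro e he e' he' h
  let c := PrimeSpectrum.comap (algebraMap A B) e
  have h₁ : c.asIdeal = e.asIdeal.comap (algebraMap A B) := rfl
  have h₂ : c.asIdeal = e'.asIdeal.comap (algebraMap A B) := congr(($h).asIdeal)
  let := (Ideal.ResidueField.map _ _ _ h₁).toAlgebra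
  let := (Ideal.ResidueField.map _ _ _ h₂).toAlgebra
  obtain ⟨L, _, _, f, g, hfg⟩ := exists_isAlgClosed_comp_algebraMap_eq c.asIdeal.ResidueField
    e.asIdeal.ResidueField e'.asIdeal.ResidueField
  have hf := PrimeSpectrum.comap_comp_algebraMap_residueField_bot e f
  have hg := PrimeSpectrum.comap_comp_algebraMap_residueField_bot e' g
  rw [← hf, ← hg]
  rw [← hf] at he
  rw [← hg] at he'
  refine congrArg (PrimeSpectrum.comap · ⊥) (hG.eq _ _ he he' ?_)
  ext a
  have := congr($hfg (algebraMap A _ a))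
  simpa [RingHom.algebraMap_toAlgebra, Ideal.ResidueField.map_algebraMap] using this

/-- The residue field extensions at the points of a geometric graph are algebraic. -/
lemma isAlgebraic (hG : IsGeometricGraph C E) (q : PrimeSpectrum B) (hq : q ∈ E) (p : Ideal A)
    [p.IsPrime] [hp : q.asIdeal.LiesOver p] : Algebra.IsAlgebraic (A ⧸ p) (B ⧸ q.asIdeal) := by
  let K := p.ResidueField
  let M := q.asIdeal.ResidueField
  let : Algebra K M := (Ideal.ResidueField.map _ _ (algebraMap A B) hp.over).toAlgebra
  have hKM (a : A) : algebraMap K M (algebraMap A K a) = algebraMap B M (algebraMap A B a) :=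
    Ideal.ResidueField.map_algebraMap _ _ _ _ _
  have : Algebra.IsAlgebraic K M := by
    refine .of_forall_algHom_eq K M fun f g ↦ ?_
    refine AlgHom.coe_ringHom_injective (Ideal.ResidueField.ringHom_ext (hG.eq _ _ ?_ ?_ ?_))
    · rwa [PrimeSpectrum.comap_comp_algebraMap_residueField_bot]
    · rwa [PrimeSpectrum.comap_comp_algebraMap_residueField_bot]
    · ext a
      simp only [RingHom.comp_apply, RingHom.coe_coe]
      rw [← hKM, f.commutes, g.commutes]
  let : Algebra (A ⧸ p) M := ((algebraMap K M).comp (algebraMap (A ⧸ p) K)).toAlgebra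
  have : IsScalarTower (A ⧸ p) K M := .of_algebraMap_eq' rfl
  have : Algebra.IsAlgebraic (A ⧸ p) M :=
    (IsFractionRing.comap_isAlgebraic_iff (K := K)).mpr inferInstance
  have : IsScalarTower (A ⧸ p) (B ⧸ q.asIdeal) M := by
    refine .of_algebraMap_eq' (Ideal.Quotient.ringHom_ext (RingHom.ext fun a ↦ ?_))
    exact hKM a
  exact .of_injective (IsScalarTower.toAlgHom (A ⧸ p) (B ⧸ q.asIdeal) M)
    (FaithfulSMul.algebraMap_injective (B ⧸ q.asIdeal) M)

end IsGeometricGraph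

section

variable {A : Type} [CommRing A] (I : Ideal A) (h : A)

lemma range_comap_algebraMap_localizationAway_quotient :
    Set.range (PrimeSpectrum.comap (algebraMap A (Localization.Away (Ideal.Quotient.mk I h)))) =
      PrimeSpectrum.zeroLocus I ∩ PrimeSpectrum.basicOpen h := by
  rw [IsScalarTower.algebraMap_eq A (A ⧸ I), PrimeSpectrum.comap_comp, Set.range_comp,
    PrimeSpectrum.localization_away_comap_range _ (Ideal.Quotient.mk I h)]
  have : (PrimeSpectrum.basicOpen (Ideal.Quotient.mk I h) : Set (PrimeSpectrum (A ⧸ I))) =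
    PrimeSpectrum.comap (Ideal.Quotient.mk I) ⁻¹' PrimeSpectrum.basicOpen h := rfl
  rw [this, Ideal.Quotient.algebraMap_eq, Set.image_preimage_eq_inter_range,
    range_comap_of_surjective _ _ Ideal.Quotient.mk_surjective, Ideal.mk_ker, Set.inter_comm]

lemma isImmersion_SpecMap_algebraMap_localizationAway_quotient : IsImmersion (Spec.map
    (CommRingCat.ofHom (algebraMap A (Localization.Away (Ideal.Quotient.mk I h))))) := by
  rw [IsScalarTower.algebraMap_eq A (A ⧸ I), CommRingCat.ofHom_comp, Spec.map_comp]
  have : IsClosedImmersion (Spec.map (CommRingCat.ofHom (algebraMap A (A ⧸ I)))) :=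
    IsClosedImmersion.spec_of_surjective _ Ideal.Quotient.mk_surjective
  infer_instance

variable {I h} in
lemma ringHom_ext_localizationAway_quotient {S : Type*} [CommRing S]
    {u v : Localization.Away (Ideal.Quotient.mk I h) →+* S}
    (huv : u.comp (algebraMap A _) = v.comp (algebraMap A _)) : u = v := by
  refine IsLocalization.ringHom_ext (.powers (Ideal.Quotient.mk I h)) ?_
  refine Ideal.Quotient.ringHom_ext ?_
  exact huv

end

/-- The morphism between the subsets `V` and `U`, endowed with their reduced induced scheme
structures, that is induced by `f` is a universal homeomorphism. -/
def IsUniversalHomeomorphismOn {X Y : Scheme} (f : X ⟶ Y) (V : Set X) (U : Set Y) : Prop :=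
  ∃ (U' V' : Scheme) (jU : U' ⟶ Y) (jV : V' ⟶ X) (g : V' ⟶ U'),
    IsReduced U' ∧ IsImmersion jU ∧ Set.range jU.base = U ∧
    IsReduced V' ∧ IsImmersion jV ∧ Set.range jV.base = V ∧
    jV ≫ f = g ≫ jU ∧ IsUniversalHomeomorphism g

lemma IsUniversalHomeomorphismOn.isLocallyClosed_target {X Y : Scheme} {f : X ⟶ Y} {V : Set X}
    {U : Set Y} (hf : IsUniversalHomeomorphismOn f V U) : IsLocallyClosed U := by
  obtain ⟨U', V', jU, jV, g, _, _, h, _⟩ := hf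
  exact h ▸ jU.isLocallyClosed_range

lemma IsUniversalHomeomorphismOn.isLocallyClosed_source {X Y : Scheme} {f : X ⟶ Y} {V : Set X}
    {U : Set Y} (hf : IsUniversalHomeomorphismOn f V U) : IsLocallyClosed V := by
  obtain ⟨U', V', jU, jV, g, _, _, _, _, _, h, _⟩ := hf
  exact h ▸ jV.isLocallyClosed_range

namespace IsGeometricGraph

variable {A B : Type} [CommRing A] [CommRing B] [Algebra A B] {C : Set (PrimeSpectrum A)}
  {E : Set (PrimeSpectrum B)}

/-- If over `U = V(p) ∩ D(h)` the set `E` equals `V(q) ∩ D(h)` and `(A ⧸ p)[1/h] → (B ⧸ q)[1/h]` is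
integral, then `E` is universally homeomorphic to `U` over `U`. -/
lemma isUniversalHomeomorphismOn (hG : IsGeometricGraph C E) (p : Ideal A) (q : Ideal B)
    [p.IsPrime] [q.IsPrime] [q.LiesOver p] (h : A)
    (hint : (Localization.awayMap (algebraMap (A ⧸ p) (B ⧸ q))
      (Ideal.Quotient.mk p h)).IsIntegral)
    {U : Set (PrimeSpectrum A)} (hU : U = PrimeSpectrum.zeroLocus p ∩ PrimeSpectrum.basicOpen h)
    (hUC : U ⊆ C)
    (hV : E ∩ PrimeSpectrum.comap (algebraMap A B) ⁻¹' U =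
      PrimeSpectrum.zeroLocus q ∩ PrimeSpectrum.basicOpen (algebraMap A B h)) :
    IsUniversalHomeomorphismOn (Spec.map (CommRingCat.ofHom (algebraMap A B)))
      (E ∩ PrimeSpectrum.comap (algebraMap A B) ⁻¹' U) U := by
  let A' := Localization.Away (Ideal.Quotient.mk p h)
  let B' := Localization.Away (Ideal.Quotient.mk q (algebraMap A B h))
  let g : A' →+* B' := Localization.awayMap (algebraMap (A ⧸ p) (B ⧸ q)) (Ideal.Quotient.mk p h)
  have hg : g.comp (algebraMap A A') = (algebraMap B B').comp (algebraMap A B) := by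
    ext a
    exact Localization.awayMap_algebraMap (algebraMap (A ⧸ p) (B ⧸ q)) _ (Ideal.Quotient.mk p a)
  have hrA : Set.range (PrimeSpectrum.comap (algebraMap A A')) = U :=
    (range_comap_algebraMap_localizationAway_quotient p h).trans hU.symm
  have hrB : Set.range (PrimeSpectrum.comap (algebraMap B B')) = _ :=
    (range_comap_algebraMap_localizationAway_quotient q (algebraMap A B h)).trans hV.symm
  have hi := isImmersion_SpecMap_algebraMap_localizationAway_quotient p h
  have hj := isImmersion_SpecMap_algebraMap_localizationAway_quotient q (algebraMap A B h)
  have hE (y : PrimeSpectrum B') : PrimeSpectrum.comap (algebraMap B B') y ∈ E :=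
    (hrB.subset ⟨y, rfl⟩).1
  have : _root_.IsReduced A' := inferInstance
  have : _root_.IsReduced B' := inferInstance
  have : IsIntegralHom (Spec.map (CommRingCat.ofHom g)) := IsIntegralHom.SpecMap_iff.mpr hint
  have : UniversallyInjective (Spec.map (CommRingCat.ofHom g)) := by
    refine universallyInjective_SpecMap g fun L _ _ u v huv ↦ ?_
    refine ringHom_ext_localizationAway_quotient (hG.eq _ _ (hE (.comap u ⊥)) (hE (.comap v ⊥)) ?_)
    rw [RingHom.comp_assoc, RingHom.comp_assoc, ← hg, ← RingHom.comp_assoc, huv,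
      RingHom.comp_assoc]
  have : Surjective (Spec.map (CommRingCat.ofHom g)) := by
    refine ⟨fun x ↦ ?_⟩
    have hx := hrA.subset ⟨x, rfl⟩
    obtain ⟨e, he, hex⟩ := hG.exists_mem (hUC hx)
    obtain ⟨y, rfl⟩ := hrB.superset ⟨he, by rwa [Set.mem_preimage, hex]⟩
    refine ⟨y, (Scheme.Hom.isEmbedding
      (Spec.map (CommRingCat.ofHom (algebraMap A A')))).injective ?_⟩
    rw [← PrimeSpectrum.comap_comp_apply, ← hg] at hex
    exact hex
  refine ⟨Spec (.of A'), Spec (.of B'), Spec.map (CommRingCat.ofHom (algebraMap A A')),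
    Spec.map (CommRingCat.ofHom (algebraMap B B')), Spec.map (CommRingCat.ofHom g),
    inferInstance, hi, hrA, inferInstance, hj, hrB, ?_, .of_universallyClosed _⟩
  rw [← Spec.map_comp, ← Spec.map_comp, ← CommRingCat.ofHom_comp, ← CommRingCat.ofHom_comp, hg]

end IsGeometricGraph

/-- Incomparability over the generic point of an algebraic extension. -/
lemma PrimeSpectrum.eq_of_le_of_comap_eq_of_isAlgebraic {A B : Type*} [CommRing A] [CommRing B]
    [Algebra A B] (p : Ideal A) (x y : PrimeSpectrum B) [x.asIdeal.LiesOver p]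
    [Algebra.IsAlgebraic (A ⧸ p) (B ⧸ x.asIdeal)] (hxy : x ≤ y)
    (h : y.asIdeal.comap (algebraMap A B) = p) : y = x := by
  refine le_antisymm (fun b hb ↦ ?_) hxy
  by_contra hbx
  refine Ideal.comap_ne_bot_of_algebraic_mem (R := A ⧸ p)
    (I := y.asIdeal.map (Ideal.Quotient.mk x.asIdeal)) (mt Ideal.Quotient.eq_zero_iff_mem.mp hbx)
    (Ideal.mem_map_of_mem _ hb) (Algebra.IsAlgebraic.isAlgebraic _) (eq_bot_iff.mpr fun a ha ↦ ?_)
  obtain ⟨a, rfl⟩ := Ideal.Quotient.mk_surjective a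
  refine Ideal.Quotient.eq_zero_iff_mem.mpr (h.le ?_)
  rw [Ideal.mem_comap]
  have : Ideal.Quotient.mk x.asIdeal (algebraMap A B a) ∈
      y.asIdeal.map (Ideal.Quotient.mk x.asIdeal) := ha
  rwa [← Ideal.mem_comap, Ideal.comap_map_of_surjective' _ Ideal.Quotient.mk_surjective,
    Ideal.mk_ker, sup_eq_left.mpr hxy] at this

/-- A geometric graph is, near each point `x` of `closure {x}`, either empty or a universal
homeomorphism onto a neighbourhood of `x` in `closure {x}`. -/
lemma IsGeometricGraph.exists_isOpen {A B : Type} [CommRing A] [CommRing B] [Algebra A B]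
    [IsNoetherianRing A] [Algebra.FiniteType A B] {C : Set (PrimeSpectrum A)}
    {E : Set (PrimeSpectrum B)} (hG : IsGeometricGraph C E) (hC : Topology.IsConstructible C)
    (hE : Topology.IsConstructible E) (x : PrimeSpectrum A) (W : Set (PrimeSpectrum A))
    (hW : IsOpen W) (hxW : x ∈ W) :
    ∃ V ⊆ W, IsOpen V ∧ x ∈ V ∧ (V ∩ closure {x} ⊆ Cᶜ ∨ V ∩ closure {x} ⊆ C ∧
      IsUniversalHomeomorphismOn (Spec.map (CommRingCat.ofHom (algebraMap A B)))
        (E ∩ PrimeSpectrum.comap (algebraMap A B) ⁻¹' (V ∩ closure {x})) (V ∩ closure {x})) := by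
  by_cases hxC : x ∉ C
  · obtain ⟨V, hV, hxV, h⟩ :=
      (Topology.isConstructible_compl.mpr hC).exists_isOpen_inter_closure_singleton_subset hxC
    exact ⟨V ∩ W, Set.inter_subset_right, hV.inter hW, ⟨hxV, hxW⟩,
      .inl fun y hy ↦ h ⟨hy.1.1, hy.2⟩⟩
  obtain ⟨e, he, hex⟩ := hG.exists_mem (not_not.mp hxC)
  let p := x.asIdeal
  have : e.asIdeal.LiesOver p := ⟨congr(($hex).asIdeal).symm⟩
  have : IsNoetherianRing B := Algebra.FiniteType.isNoetherianRing A B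
  have : Algebra.IsAlgebraic (A ⧸ p) (B ⧸ e.asIdeal) := hG.isAlgebraic e he p
  let π := PrimeSpectrum.comap (algebraMap A B)
  let D := (E \ closure {e} ∪ closure {e} \ E) ∩ π ⁻¹' closure {x}
  have hcl {Z : Set (PrimeSpectrum B)} (hZ : IsClosed Z) : Topology.IsConstructible Z :=
    IsConstructibleSet.isConstructible
      ⟨1, fun _ ↦ Z, fun _ ↦ hZ.isLocallyClosed, (Set.iUnion_const _).symm⟩
  have hD : Topology.IsConstructible D :=
    ((hE.sdiff (hcl isClosed_closure)).union ((hcl isClosed_closure).sdiff hE)).inter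
      (hcl (isClosed_closure.preimage (PrimeSpectrum.continuous_comap _)))
  have hπD : Topology.IsConstructible (π '' D)ᶜ :=
    Topology.isConstructible_compl.mpr (PrimeSpectrum.isConstructible_comap_image
      (RingHom.FinitePresentation.of_finiteType.mp
        (RingHom.finiteType_algebraMap.mpr inferInstance)) hD)
  have hxD : x ∈ (π '' D)ᶜ := by
    rintro ⟨y, ⟨⟨hyE, hy⟩ | ⟨hy, hyE⟩, -⟩, hyx⟩
    · exact hy (hG.injOn hyE he (hyx.trans hex.symm) ▸ subset_closure rfl)
    · rw [← specializes_iff_mem_closure, ← PrimeSpectrum.le_iff_specializes] at hy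
      exact hyE (PrimeSpectrum.eq_of_le_of_comap_eq_of_isAlgebraic p e y hy
        congr(($hyx).asIdeal) ▸ he)
  obtain ⟨W₁, hW₁, hxW₁, h₁⟩ := hC.exists_isOpen_inter_closure_singleton_subset (not_not.mp hxC)
  obtain ⟨W₂, hW₂, hxW₂, h₂⟩ := hπD.exists_isOpen_inter_closure_singleton_subset hxD
  obtain ⟨_, ⟨h', rfl⟩, hxh', hh'⟩ :=
    PrimeSpectrum.isTopologicalBasis_basic_opens.exists_subset_of_mem_open
      (show x ∈ W ∩ W₁ ∩ W₂ from ⟨⟨hxW, hxW₁⟩, hxW₂⟩) ((hW.inter hW₁).inter hW₂)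
  obtain ⟨r, hr0, hr⟩ :=
    Algebra.FiniteType.exists_forall_isIntegral_awayMap (A ⧸ p) (B ⧸ e.asIdeal)
  obtain ⟨r, rfl⟩ := Ideal.Quotient.mk_surjective r
  have hxr : x ∈ PrimeSpectrum.basicOpen r := mt Ideal.Quotient.eq_zero_iff_mem.mpr hr0
  have hrh' : PrimeSpectrum.basicOpen (r * h') ≤ PrimeSpectrum.basicOpen h' :=
    PrimeSpectrum.basicOpen_mul_le_right r h'
  let V : Set (PrimeSpectrum A) := PrimeSpectrum.basicOpen (r * h')
  have hVC : V ∩ closure {x} ⊆ C := fun y hy ↦ h₁ ⟨(hh' (hrh' hy.1)).1.2, hy.2⟩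
  refine ⟨V, fun y hy ↦ (hh' (hrh' hy)).1.1, (PrimeSpectrum.basicOpen _).isOpen, ?_, .inr ⟨hVC, ?_⟩⟩
  · exact (PrimeSpectrum.basicOpen_mul r h').ge ⟨hxr, hxh'⟩
  refine hG.isUniversalHomeomorphismOn p e.asIdeal (r * h')
    (hr _ (by rw [map_mul]; exact dvd_mul_right _ _))
    (by rw [PrimeSpectrum.closure_singleton, Set.inter_comm]) hVC ?_
  ext y
  rw [← PrimeSpectrum.closure_singleton]
  constructor
  · rintro ⟨hyE, hyV, hyx⟩
    refine ⟨by_contra fun hye ↦ ?_, hyV⟩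
    exact h₂ ⟨(hh' (hrh' hyV)).2, hyx⟩ ⟨y, ⟨.inl ⟨hyE, hye⟩, hyx⟩, rfl⟩
  · rintro ⟨hye, hyV⟩
    have hyx : π y ∈ closure {x} := by
      rw [← specializes_iff_mem_closure] at hye ⊢
      exact hex ▸ hye.map (PrimeSpectrum.continuous_comap _)
    refine ⟨by_contra fun hyE ↦ ?_, hyV, hyx⟩
    exact h₂ ⟨(hh' (hrh' hyV)).2, hyx⟩ ⟨y, ⟨.inr ⟨hye, hyE⟩, hyx⟩, rfl⟩

lemma ptOf_eq_comap {F : Type} [Field F] {r : ℕ} {L : Type} [Field L] [Algebra F L]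
    (f : MvPolynomial (Fin r) F →+* L) (hf : f.comp MvPolynomial.C = algebraMap F L) :
    ptOf F r L (fun i ↦ f (MvPolynomial.X i)) = PrimeSpectrum.comap f ⊥ := by
  have : (MvPolynomial.aeval fun i ↦ f (MvPolynomial.X i)).toRingHom = f := by
    ext x
    · simpa using congr($hf x).symm
    · simp
  conv_rhs => rw [← this]
  rfl

lemma isGeometricGraph_of_Lpoints (F : Type) [Field F] (m n : ℕ)
    (C : Set (AffSp F m)) (E : Set (AffSp F (m + n)))
    (hgraph : ∀ (L : Type) [Field L] [Algebra F L] [IsAlgClosed L],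
      (∀ e ∈ Lpoints F (m + n) E L, (fun i => e (Fin.castAdd n i)) ∈ Lpoints F m C L) ∧
      (∀ c ∈ Lpoints F m C L,
        ∃! e, e ∈ Lpoints F (m + n) E L ∧ (fun i => e (Fin.castAdd n i)) = c)) :
    letI : Algebra (MvPolynomial (Fin m) F) (MvPolynomial (Fin (m + n)) F) :=
      (MvPolynomial.rename (Fin.castAdd n)).toAlgebra
    IsGeometricGraph (A := MvPolynomial (Fin m) F) (B := MvPolynomial (Fin (m + n)) F) C E := by
  let : Algebra (MvPolynomial (Fin m) F) (MvPolynomial (Fin (m + n)) F) :=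
    (MvPolynomial.rename (Fin.castAdd n)).toAlgebra
  let φ := algebraMap (MvPolynomial (Fin m) F) (MvPolynomial (Fin (m + n)) F)
  have hφC (x : F) : φ (MvPolynomial.C x) = MvPolynomial.C x := MvPolynomial.rename_C _ _
  have hφX (i : Fin m) : φ (MvPolynomial.X i) = MvPolynomial.X (Fin.castAdd n i) :=
    MvPolynomial.rename_X _ _
  have hmem {L : Type} [Field L] [Algebra F L] [IsAlgClosed L]
      (f : MvPolynomial (Fin (m + n)) F →+* L) (hf : f.comp MvPolynomial.C = algebraMap F L)
      (hfE : PrimeSpectrum.comap f ⊥ ∈ E) :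
      (fun i ↦ f (MvPolynomial.X i)) ∈ Lpoints F (m + n) E L := by
    rwa [← ptOf_eq_comap f hf] at hfE
  have hmem' {L : Type} [Field L] [IsAlgClosed L]
      (f : MvPolynomial (Fin (m + n)) F →+* L) (hfE : PrimeSpectrum.comap f ⊥ ∈ E) :
      PrimeSpectrum.comap (f.comp φ) ⊥ ∈ C := by
    let : Algebra F L := (f.comp MvPolynomial.C).toAlgebra
    have : ptOf F m L _ ∈ C := (hgraph L).1 _ (hmem f rfl hfE)
    rw [← ptOf_eq_comap (f.comp φ) (RingHom.ext fun x ↦ by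
      simp [hφC, RingHom.algebraMap_toAlgebra])]
    simp only [RingHom.comp_apply, hφX]
    exact this
  refine ⟨hmem', fun {L} _ _ f g hf hg h ↦ ?_, fun {L} _ _ c hc ↦ ?_⟩
  · let : Algebra F L := (f.comp MvPolynomial.C).toAlgebra
    have hC : g.comp MvPolynomial.C = algebraMap F L := RingHom.ext fun x ↦ by
      have : f (φ (MvPolynomial.C x)) = g (φ (MvPolynomial.C x)) := congr($h _)
      rw [hφC] at this
      exact this.symm
    have hX (i : Fin m) : g (MvPolynomial.X (Fin.castAdd n i)) =
        f (MvPolynomial.X (Fin.castAdd n i)) := by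
      have : f (φ (MvPolynomial.X i)) = g (φ (MvPolynomial.X i)) := congr($h _)
      rw [hφX] at this
      exact this.symm
    have hc := (hgraph L).1 _ (hmem f rfl hf)
    have := ((hgraph L).2 _ hc).unique ⟨hmem g hC hg, funext hX⟩ ⟨hmem f rfl hf, rfl⟩
    refine MvPolynomial.ringHom_ext (fun x ↦ congr($hC x).symm) fun i ↦ congr($this i).symm
  · let : Algebra F L := (c.comp MvPolynomial.C).toAlgebra
    have hc' : (fun i ↦ c (MvPolynomial.X i)) ∈ Lpoints F m C L := by
      rwa [← ptOf_eq_comap c rfl] at hc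
    obtain ⟨e, ⟨he, hec⟩, -⟩ := (hgraph L).2 _ hc'
    refine ⟨(MvPolynomial.aeval e).toRingHom, he, MvPolynomial.ringHom_ext (fun x ↦ ?_) fun i ↦ ?_⟩
    · change MvPolynomial.aeval e (φ (MvPolynomial.C x)) = _
      simp [hφC, RingHom.algebraMap_toAlgebra]
    · change MvPolynomial.aeval e (φ (MvPolynomial.X i)) = _
      simpa [hφX] using congr($hec i)

/-- `C` is a constructible subset of `𝔸^m_F`, `E` a constructible subset of
`𝔸^{m+n}_F`, and for every algebraically closed field `L` containing `F` the set `E(L)`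
is the graph of a function with domain of definition `C(L)`.  Then there is a finite
partition `U_1, …, U_r` of `C` into locally closed subsets of `𝔸^m_F` such that the sets
`V_i := E ∩ π⁻¹(U_i)` form a partition of `E` into locally closed subsets of `𝔸^{m+n}_F`
and, for every `i`, the morphism `V_i ⟶ U_i` induced by the projection `π` (with `U_i`,
`V_i` carrying their reduced induced structures, i.e. realized as reduced schemes
immersed in the affine spaces with images `U_i`, `V_i`) is a universal homeomorphism. -/
theorem statement7 (F : Type) [Field F] (m n : ℕ)
    (C : Set (AffSp F m)) (E : Set (AffSp F (m + n)))
    (hC : IsConstructibleSet C) (hE : IsConstructibleSet E)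
    (hgraph : ∀ (L : Type) [Field L] [Algebra F L] [IsAlgClosed L],
      (∀ e ∈ Lpoints F (m + n) E L, (fun i => e (Fin.castAdd n i)) ∈ Lpoints F m C L) ∧
      (∀ c ∈ Lpoints F m C L,
        ∃! e, e ∈ Lpoints F (m + n) E L ∧ (fun i => e (Fin.castAdd n i)) = c)) :
    ∃ (r : ℕ) (U : Fin r → Set (AffSp F m)),
      (∀ i, IsLocallyClosed (U i)) ∧
      (⋃ i, U i) = C ∧
      (∀ i j, i ≠ j → Disjoint (U i) (U j)) ∧
      (∀ i, IsLocallyClosed (E ∩ (projAff F m n).base ⁻¹' (U i))) ∧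
      (⋃ i, E ∩ (projAff F m n).base ⁻¹' (U i)) = E ∧
      (∀ i j, i ≠ j →
        Disjoint (E ∩ (projAff F m n).base ⁻¹' (U i))
          (E ∩ (projAff F m n).base ⁻¹' (U j))) ∧
      ∀ i, ∃ (U' V' : Scheme) (jU : U' ⟶ AffSp F m)
          (jV : V' ⟶ AffSp F (m + n)) (g : V' ⟶ U'),
        IsReduced U' ∧ IsImmersion jU ∧ Set.range jU.base = U i ∧
        IsReduced V' ∧ IsImmersion jV ∧
        Set.range jV.base = E ∩ (projAff F m n).base ⁻¹' (U i) ∧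
        jV ≫ projAff F m n = g ≫ jU ∧
        IsUniversalHomeomorphism g := by
  let : Algebra (MvPolynomial (Fin m) F) (MvPolynomial (Fin (m + n)) F) :=
    (MvPolynomial.rename (Fin.castAdd n)).toAlgebra
  have : IsScalarTower F (MvPolynomial (Fin m) F) (MvPolynomial (Fin (m + n)) F) :=
    .of_algHom (MvPolynomial.rename (Fin.castAdd n))
  have : Algebra.FiniteType (MvPolynomial (Fin m) F) (MvPolynomial (Fin (m + n)) F) :=
    .of_restrictScalars_finiteType F _ _
  have hG := isGeometricGraph_of_Lpoints F m n C E hgraph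
  obtain ⟨S, hSG, hSC, hSd⟩ := exists_finset_pairwiseDisjoint_sUnion_eq
    (X := PrimeSpectrum (MvPolynomial (Fin m) F)) C
    (fun U ↦ IsUniversalHomeomorphismOn (projAff F m n) (E ∩ (projAff F m n).base ⁻¹' U) U)
    (hG.exists_isOpen (IsConstructibleSet.isConstructible hC)
      (IsConstructibleSet.isConstructible hE))
  let U (i : Fin S.card) : Set (AffSp F m) := (S.equivFin.symm i).1
  have hU (i) : IsUniversalHomeomorphismOn (projAff F m n)
    (E ∩ (projAff F m n).base ⁻¹' U i) (U i) := hSG _ (S.equivFin.symm i).2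
  have hUC : ⋃ i, U i = C := by
    rw [← hSC, Set.sUnion_eq_iUnion]
    exact S.equivFin.symm.surjective.iUnion_comp fun s : S ↦ s.1
  have hUd (i j) (hij : i ≠ j) : Disjoint (U i) (U j) :=
    hSd (S.equivFin.symm i).2 (S.equivFin.symm j).2
      (Subtype.val_injective.ne (S.equivFin.symm.injective.ne hij))
  refine ⟨S.card, U, fun i ↦ (hU i).isLocallyClosed_target, hUC, hUd,
    fun i ↦ (hU i).isLocallyClosed_source, ?_, fun i j hij ↦ ?_, hU⟩
  · rw [← Set.inter_iUnion, ← Set.preimage_iUnion, hUC]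
    exact Set.inter_eq_left.mpr fun e he ↦ hG.mapsTo he
  · exact ((hUd i j hij).preimage _).mono Set.inter_subset_right Set.inter_subset_right
end
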